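/- arXiv:1004.2984 — 2 statements merged into one kernel-verified Lean document; each statement's English description precedes it below -/
import Mathlib

section
/- C¹ linearization of the Wainwright–Hsu vector field near non-preperiodic Kasner points: let p ∈ 𝒦 be a point which is not a Taub point and whose Kasner parameter u is neither rational nor a quadratic irrational. Then there exist ε > 0, an open set U ⊆ ℝ⁶ containing p, continuous functions λ₁ˢ, λ₂ˢ, λᵘ : (−ε,ε) → ℝ with λ₁ˢ(y) < λ₂ˢ(y) < 0 < λᵘ(y) for all y ∈ (−ε,ε), and a C¹ map φ : (−ε,ε)⁴ → ℝ⁶ which is a homeomorphism onto U ∩ ℬ with φ(0,0,0,0) = p, such that for every (x₁,x₂,y,z) ∈ (−ε,ε)⁴ the derivative of φ at (x₁,x₂,y,z) applied to the vector (λ₁ˢ(y)x₁, λ₂ˢ(y)x₂, 0, λᵘ(y)z) equals X(φ(x₁,x₂,y,z)); moreover 𝒦 ∩ U = φ({(0,0,y,0) : y ∈ (−ε,ε)}). -/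
noncomputable section

/-- `q = (Σ₁²+Σ₂²+Σ₃²)/3`. Coordinates: `p 0,p 1,p 2 = Σ₁,Σ₂,Σ₃`, `p 3,p 4,p 5 = N₁,N₂,N₃`. -/
def WHq (p : Fin 6 → ℝ) : ℝ := (p 0 ^ 2 + p 1 ^ 2 + p 2 ^ 2) / 3

/-- The Wainwright–Hsu vector field on ℝ⁶. -/
def WHX (p : Fin 6 → ℝ) : Fin 6 → ℝ :=
  ![(2 - WHq p) * p 0
      - (2 * p 3 ^ 2 - p 4 ^ 2 - p 5 ^ 2 + 2 * p 4 * p 5 - p 3 * p 4 - p 3 * p 5) / 3,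
    (2 - WHq p) * p 1
      - (2 * p 4 ^ 2 - p 5 ^ 2 - p 3 ^ 2 + 2 * p 5 * p 3 - p 4 * p 5 - p 4 * p 3) / 3,
    (2 - WHq p) * p 2
      - (2 * p 5 ^ 2 - p 3 ^ 2 - p 4 ^ 2 + 2 * p 3 * p 4 - p 5 * p 3 - p 5 * p 4) / 3,
    -(WHq p + 2 * p 0) * p 3,
    -(WHq p + 2 * p 1) * p 4,
    -(WHq p + 2 * p 2) * p 5]

/-- `Ω = 6 − (Σ₁²+Σ₂²+Σ₃²) + (1/2)(N₁²+N₂²+N₃²) − (N₁N₂+N₁N₃+N₂N₃)`. -/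
def WHOmega (p : Fin 6 → ℝ) : ℝ :=
  6 - (p 0 ^ 2 + p 1 ^ 2 + p 2 ^ 2) + (1 / 2) * (p 3 ^ 2 + p 4 ^ 2 + p 5 ^ 2)
    - (p 3 * p 4 + p 3 * p 5 + p 4 * p 5)

/-- The phase space ℬ. -/
def WHB : Set (Fin 6 → ℝ) := {p | p 0 + p 1 + p 2 = 0 ∧ WHOmega p = 0}


/-- The Kasner circle 𝒦. -/
def KasnerCircle : Set (Fin 6 → ℝ) :=
  {p | p 0 + p 1 + p 2 = 0 ∧ p 0 ^ 2 + p 1 ^ 2 + p 2 ^ 2 = 6 ∧ p 3 = 0 ∧ p 4 = 0 ∧ p 5 = 0}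

/-- `p` is one of the three Taub points `T₁,T₂,T₃`. -/
def IsTaub (p : Fin 6 → ℝ) : Prop :=
  (p 0 = 2 ∧ p 1 = -1 ∧ p 2 = -1) ∨ (p 0 = -1 ∧ p 1 = 2 ∧ p 2 = -1) ∨
    (p 0 = -1 ∧ p 1 = -1 ∧ p 2 = 2)

/-- A real number is a quadratic irrational if it is irrational and is a root of a
quadratic polynomial with integer coefficients (with nonzero leading coefficient). -/
def IsQuadraticIrrational (u : ℝ) : Prop :=
  Irrational u ∧ ∃ a b c : ℤ, a ≠ 0 ∧ (a : ℝ) * u ^ 2 + (b : ℝ) * u + (c : ℝ) = 0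

/-- The open cube `(−ε,ε)⁴`, with coordinates `(x₁, x₂, y, z)` indexed by `0,1,2,3`. -/
def Cube4 (ε : ℝ) : Set (Fin 4 → ℝ) := {x | ∀ i, x i ∈ Set.Ioo (-ε) ε}

section

open Set Metric Filter Topology MeasureTheory
open scoped NNReal

section Flow

variable {E F : Type*} [NormedAddCommGroup E] [NormedSpace ℝ E]
  [NormedAddCommGroup F] [NormedSpace ℝ F]

/-- A map of class `C¹` on a proper space is Lipschitz on every ball. -/
lemma ContDiff.exists_lipschitzOnWith_closedBall [ProperSpace E] {V : E → F}
    (hV : ContDiff ℝ 1 V) (x : E) (r : ℝ) : ∃ K : ℝ≥0, LipschitzOnWith K V (closedBall x r) := by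
  have hc : Continuous fun p => ‖fderiv ℝ V p‖₊ := (hV.continuous_fderiv one_ne_zero).nnnorm
  obtain ⟨K, hK⟩ := (isCompact_closedBall x r).bddAbove_image hc.continuousOn
  refine ⟨K, (convex_closedBall x r).lipschitzOnWith_of_nnnorm_fderiv_le (𝕜 := ℝ)
    (fun p _ => (hV.differentiable one_ne_zero) p) fun p hp => hK (mem_image_of_mem _ hp)⟩

lemma isMIntegralCurve_of_hasDerivAt {V : E → E} {γ : ℝ → E}
    (h : ∀ t, HasDerivAt γ (V (γ t)) t) :
    IsMIntegralCurve (I := modelWithCornersSelf ℝ E) γ V := fun t =>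
  (h t).hasFDerivAt.hasMFDerivAt

lemma exists_integralCurve_of_linear_growth [ProperSpace E] [CompleteSpace E] {V : E → E}
    (hV : ContDiff ℝ 1 V) {C : ℝ} (hC : 0 < C) (hg : ∀ p, ‖V p‖ ≤ C * (1 + ‖p‖)) (p : E) :
    ∃ γ : ℝ → E, γ 0 = p ∧ ∀ t, HasDerivAt γ (V (γ t)) t := by
  have key : ∃ γ : ℝ → E, γ 0 = p ∧ IsMIntegralCurve (I := modelWithCornersSelf ℝ E) γ V := by
    refine exists_isMIntegralCurve_of_isMIntegralCurveOn
      (contMDiff_vectorSpace_iff_contDiff.2 hV) (ε := 1 / (2 * C)) (by positivity) (fun x => ?_) p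
    obtain ⟨K, hK⟩ := hV.exists_lipschitzOnWith_closedBall x (1 + ‖x‖)
    have h0 : (0 : ℝ) ∈ Icc (-(1 / (2 * C))) (1 / (2 * C)) := by
      have : 0 < 1 / (2 * C) := by positivity
      constructor <;> linarith
    have hPL : IsPicardLindelof (fun _ => V) (⟨0, h0⟩ : Icc (-(1 / (2 * C))) (1 / (2 * C))) x
        ⟨1 + ‖x‖, by positivity⟩ 0 ⟨2 * C * (1 + ‖x‖), by positivity⟩ K := by
      refine ⟨fun _ _ => hK, fun _ _ => continuousOn_const, fun t _ y hy => ?_, ?_⟩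
      · refine (hg y).trans ?_
        have h1 : ‖y‖ ≤ ‖x‖ + (1 + ‖x‖) := by
          have := norm_le_norm_add_norm_sub x y
          have h2 : ‖y - x‖ ≤ 1 + ‖x‖ := by
            rw [← dist_eq_norm]; exact mem_closedBall.1 hy
          rw [norm_sub_rev] at h2
          linarith
        change _ ≤ 2 * C * (1 + ‖x‖)
        nlinarith
      · simp only [sub_zero, zero_sub, neg_neg, max_self, NNReal.coe_zero]
        change 2 * C * (1 + ‖x‖) * (1 / (2 * C)) ≤ 1 + ‖x‖
        apply le_of_eq
        field_simp
    obtain ⟨α, hα0, hα⟩ := hPL.exists_eq_forall_mem_Icc_hasDerivWithinAt₀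
    refine ⟨α, hα0, fun t ht => ?_⟩
    exact ((hα t (Ioo_subset_Icc_self ht)).mono Ioo_subset_Icc_self).hasFDerivWithinAt.hasMFDerivWithinAt
  obtain ⟨γ, h0, h⟩ := key
  refine ⟨γ, h0, fun t => ?_⟩
  have ht : HasFDerivAt γ ((1 : ℝ →L[ℝ] ℝ).smulRight (V (γ t))) t := (h t).hasFDerivAt
  exact ht.hasDerivAt.congr_deriv (by simp)

lemma integralCurve_unique [CompleteSpace E] {V : E → E} (hV : ContDiff ℝ 1 V) {γ γ' : ℝ → E}
    (h : ∀ t, HasDerivAt γ (V (γ t)) t) (h' : ∀ t, HasDerivAt γ' (V (γ' t)) t)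
    (h0 : γ 0 = γ' 0) : γ = γ' :=
  isMIntegralCurve_Ioo_eq_of_contMDiff_boundaryless (t₀ := 0)
    (contMDiff_vectorSpace_iff_contDiff.2 hV) 
    (isMIntegralCurve_of_hasDerivAt h) (isMIntegralCurve_of_hasDerivAt h') h0

/-- `Φ` is a global flow of the vector field `V`. -/
structure IsFlow (V : E → E) (Φ : ℝ → E → E) : Prop where
  zero : ∀ p, Φ 0 p = p
  deriv : ∀ t p, HasDerivAt (fun s => Φ s p) (V (Φ t p)) t

lemma exists_isFlow [ProperSpace E] [CompleteSpace E] {V : E → E}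
    (hV : ContDiff ℝ 1 V) {C : ℝ} (hC : 0 < C) (hg : ∀ p, ‖V p‖ ≤ C * (1 + ‖p‖)) :
    ∃ Φ, IsFlow V Φ := by
  choose γ h0 h using exists_integralCurve_of_linear_growth hV hC hg
  exact ⟨fun t p => γ p t, h0, fun t p => h p t⟩

namespace IsFlow

variable {V : E → E} {Φ : ℝ → E → E}

lemma continuous_time (hΦ : IsFlow V Φ) (p : E) : Continuous fun t => Φ t p :=
  continuous_iff_continuousAt.2 fun t => (hΦ.deriv t p).continuousAt

lemma add [CompleteSpace E] (hΦ : IsFlow V Φ) (hV : ContDiff ℝ 1 V) (s t : ℝ) (p : E) :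
    Φ (t + s) p = Φ t (Φ s p) := by
  have := integralCurve_unique hV (γ := fun t => Φ (t + s) p) (γ' := fun t => Φ t (Φ s p))
    (fun t => (hΦ.deriv (t + s) p).comp_add_const t s) (fun t => hΦ.deriv t _)
    (by simp [hΦ.zero])
  exact congrFun this t

lemma exists_norm_le (hΦ : IsFlow V Φ) {C : ℝ} (hC : 0 < C) (hg : ∀ p, ‖V p‖ ≤ C * (1 + ‖p‖))
    (r T : ℝ) : ∃ M, ∀ p, ‖p‖ ≤ r → ∀ t ∈ Icc 0 T, ‖Φ t p‖ ≤ M := by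
  refine ⟨gronwallBound r C C T, fun p hp t ht => ?_⟩
  have h := norm_le_gronwallBound_of_norm_deriv_right_le (f := fun t => Φ t p)
    (f' := fun t => V (Φ t p)) (δ := r) (K := C) (ε := C) (a := 0) (b := T)
    (hΦ.continuous_time p).continuousOn (fun t _ => (hΦ.deriv t p).hasDerivWithinAt)
    (by simpa [hΦ.zero] using hp) (fun t _ => (hg _).trans (by linarith)) t ht
  rw [sub_zero] at h
  exact h.trans (gronwallBound_mono ((norm_nonneg p).trans hp) hC.le hC.le ht.2)

lemma exists_lipschitz [ProperSpace E] (hΦ : IsFlow V Φ) (hV : ContDiff ℝ 1 V) {C : ℝ}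
    (hC : 0 < C) (hg : ∀ p, ‖V p‖ ≤ C * (1 + ‖p‖)) (r T : ℝ) :
    ∃ L, 0 ≤ L ∧ ∀ p q, ‖p‖ ≤ r → ‖q‖ ≤ r → ∀ t ∈ Icc 0 T, ‖Φ t p - Φ t q‖ ≤ L * ‖p - q‖ := by
  obtain ⟨M, hM⟩ := hΦ.exists_norm_le hC hg r T
  obtain ⟨K, hK⟩ := hV.exists_lipschitzOnWith_closedBall 0 M
  refine ⟨Real.exp (K * T), (Real.exp_pos _).le, fun p q hp hq t ht => ?_⟩
  have h := dist_le_of_trajectories_ODE_of_mem (v := fun _ => V) (s := fun _ => closedBall 0 M)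
    (f := fun t => Φ t p) (g := fun t => Φ t q) (a := 0) (b := T) (δ := ‖p - q‖) (fun _ _ => hK)
    (hΦ.continuous_time p).continuousOn (fun t _ => (hΦ.deriv t p).hasDerivWithinAt)
    (fun t ht => by simpa using hM p hp t (Ico_subset_Icc_self ht))
    (hΦ.continuous_time q).continuousOn (fun t _ => (hΦ.deriv t q).hasDerivWithinAt)
    (fun t ht => by simpa using hM q hq t (Ico_subset_Icc_self ht))
    (by simp [hΦ.zero, dist_eq_norm]) t ht
  rw [dist_eq_norm, sub_zero] at h
  refine h.trans ?_
  rw [mul_comm]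
  gcongr
  exact ht.2

lemma continuous_space [ProperSpace E] (hΦ : IsFlow V Φ) (hV : ContDiff ℝ 1 V) {C : ℝ}
    (hC : 0 < C) (hg : ∀ p, ‖V p‖ ≤ C * (1 + ‖p‖)) {t : ℝ} (ht : 0 ≤ t) :
    Continuous (Φ t) := by
  rw [continuous_iff_continuousAt]
  intro p
  obtain ⟨L, hL, h⟩ := hΦ.exists_lipschitz hV hC hg (‖p‖ + 1) t
  refine continuousAt_of_locally_lipschitz zero_lt_one L fun q hq => ?_
  rw [dist_eq_norm] at hq ⊢
  rw [dist_eq_norm]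
  refine h q p ?_ (by linarith) t ⟨ht, le_rfl⟩
  have := norm_le_norm_add_norm_sub p q
  rw [norm_sub_rev] at this
  linarith

end IsFlow

end Flow

section Flow
variable {E : Type*} [NormedAddCommGroup E] [NormedSpace ℝ E]

/-- `Φ` is a global flow of `V`, and `L t p` is its space derivative for nonnegative times,
depending continuously on `p` and solving the variational equation. -/
structure IsSmoothFlow (V : E → E) (Φ : ℝ → E → E) (L : ℝ → E → E →L[ℝ] E) : Prop
    extends IsFlow V Φ where
  fderiv_zero : ∀ p, L 0 p = ContinuousLinearMap.id ℝ E
  fderiv_deriv : ∀ t p, HasDerivAt (fun s => L s p) ((fderiv ℝ V (Φ t p)).comp (L t p)) t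
  hasFDerivAt : ∀ t, 0 ≤ t → ∀ p, HasFDerivAt (Φ t) (L t p) p
  continuous_fderiv : ∀ t, 0 ≤ t → Continuous (L t)

theorem exists_isSmoothFlow [FiniteDimensional ℝ E] {V : E → E} (hV : ContDiff ℝ 2 V) {K : ℝ}
    (hK : ∀ p, ‖fderiv ℝ V p‖ ≤ K) : ∃ Φ L, IsSmoothFlow V Φ L := by
  have : CompleteSpace E := FiniteDimensional.complete ℝ E
  have : ProperSpace E := FiniteDimensional.proper ℝ E
  have hK0 : 0 ≤ K := (norm_nonneg _).trans (hK 0)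
  have hV1 : ContDiff ℝ 1 V := hV.of_le one_le_two
  have hdV : ContDiff ℝ 1 (fderiv ℝ V) := hV.fderiv_right (by norm_num [one_add_one_eq_two])
  have hVd : Differentiable ℝ V := hV1.differentiable one_ne_zero
  set C : ℝ := ‖V 0‖ + K + 1 with hCdef
  have hC : 0 < C := by positivity
  have hg : ∀ p, ‖V p‖ ≤ C * (1 + ‖p‖) := fun p => by
    have h1 := (convex_univ (𝕜 := ℝ) (E := E)).norm_image_sub_le_of_norm_fderiv_le
      (fun x _ => hVd x) (fun x _ => hK x) (mem_univ 0) (mem_univ p)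
    rw [sub_zero] at h1
    have h2 := norm_le_norm_add_norm_sub (V 0) (V p)
    rw [norm_sub_rev] at h2
    nlinarith [norm_nonneg p, norm_nonneg (V 0), mul_nonneg (norm_nonneg (V 0)) (norm_nonneg p)]
  let W : E × (E →L[ℝ] E) → E × (E →L[ℝ] E) := fun w => (V w.1, (fderiv ℝ V w.1).comp w.2)
  have hW : ContDiff ℝ 1 W :=
    (hV1.comp contDiff_fst).prodMk ((hdV.comp contDiff_fst).clm_comp contDiff_snd)
  have hgW : ∀ w, ‖W w‖ ≤ C * (1 + ‖w‖) := fun w => by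
    refine norm_prod_le_iff.2 ⟨(hg _).trans ?_, ?_⟩
    · gcongr
      exact norm_fst_le w
    · refine (ContinuousLinearMap.opNorm_comp_le _ _).trans ?_
      have h1 := hK w.1
      have h2 := norm_snd_le w
      have h3 : ‖fderiv ℝ V w.1‖ * ‖w.2‖ ≤ K * ‖w‖ := by gcongr
      nlinarith [norm_nonneg w, norm_nonneg (V 0), mul_nonneg (norm_nonneg (V 0)) (norm_nonneg w)]
  obtain ⟨Ψ, hΨ⟩ := exists_isFlow hW hC hgW
  let ι : E → E × (E →L[ℝ] E) := fun p => (p, ContinuousLinearMap.id ℝ E)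
  have hΦ : IsFlow V fun t p => (Ψ t (ι p)).1 :=
    ⟨fun p => by simp [hΨ.zero, ι],
      fun t p => (ContinuousLinearMap.fst ℝ E (E →L[ℝ] E)).hasFDerivAt.comp_hasDerivAt t (hΨ.deriv t (ι p))⟩
  have hL : ∀ t p, HasDerivAt (fun s => (Ψ s (ι p)).2)
      ((fderiv ℝ V (Ψ t (ι p)).1).comp (Ψ t (ι p)).2) t :=
    fun t p => (ContinuousLinearMap.snd ℝ E (E →L[ℝ] E)).hasFDerivAt.comp_hasDerivAt t (hΨ.deriv t (ι p))
  refine ⟨fun t p => (Ψ t (ι p)).1, fun t p => (Ψ t (ι p)).2, hΦ, fun p => by simp [hΨ.zero, ι],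
    hL, fun T hT p => ?_, fun t ht => ?_⟩
  · obtain ⟨M, hM⟩ := hΦ.exists_norm_le hC hg (‖p‖ + 1) T
    obtain ⟨L₀, hL₀, hlip⟩ := hΦ.exists_lipschitz hV1 hC hg (‖p‖ + 1) T
    obtain ⟨K₂, hK₂⟩ := hdV.exists_lipschitzOnWith_closedBall 0 M
    set c : ℝ := K₂ * L₀ ^ 2 / (K + 1) * (Real.exp ((K + 1) * T) - 1) with hc
    refine HasFDerivAt.of_isLittleO ((Asymptotics.IsBigO.of_bound c ?_).trans_isLittleO
      (Asymptotics.isLittleO_pow_sub_sub p one_lt_two))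
    filter_upwards [ball_mem_nhds p one_pos] with q hq
    rw [mem_ball, dist_eq_norm] at hq
    have hq' : ‖q‖ ≤ ‖p‖ + 1 := by
      have := norm_le_norm_add_norm_sub p q
      rw [norm_sub_rev] at this
      linarith
    have hp' : ‖p‖ ≤ ‖p‖ + 1 := by linarith
    set φq : ℝ → E := fun t => (Ψ t (ι q)).1
    set φp : ℝ → E := fun t => (Ψ t (ι p)).1
    set A : ℝ → E →L[ℝ] E := fun t => (Ψ t (ι p)).2
    have hd : ∀ t, HasDerivAt (fun t => φq t - φp t - A t (q - p))
        (V (φq t) - V (φp t) - fderiv ℝ V (φp t) (A t (q - p))) t := fun t =>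
      ((hΦ.deriv t q).sub (hΦ.deriv t p)).sub
        ((hL t p).clm_apply (hasDerivAt_const t (q - p)) |>.congr_deriv (by simp [φp, A]))
    have hgr := norm_le_gronwallBound_of_norm_deriv_right_le (δ := 0) (K := K + 1)
      (ε := K₂ * (L₀ * ‖q - p‖) ^ 2) (a := 0) (b := T)
      (continuous_iff_continuousAt.2 fun t => (hd t).continuousAt).continuousOn
      (fun t _ => (hd t).hasDerivWithinAt)
      (by simp [φp, φq, A, hΨ.zero, ι]) (fun t ht => ?_) T ⟨hT, le_rfl⟩
    · rw [gronwallBound_of_K_ne_0 (by positivity)] at hgr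
      refine hgr.trans (le_of_eq ?_)
      simp only [hc, norm_pow, norm_norm, sub_zero]
      ring
    · have ht' := Ico_subset_Icc_self ht
      have hbq : φq t ∈ closedBall (0 : E) M := by simpa using hM q hq' t ht'
      have hbp : φp t ∈ closedBall (0 : E) M := by simpa using hM p hp' t ht'
      have hseg : segment ℝ (φp t) (φq t) ⊆ closedBall 0 M :=
        (convex_closedBall _ _).segment_subset hbp hbq
      have hmv := (convex_segment (φp t) (φq t)).norm_image_sub_le_of_norm_fderiv_le' (𝕜 := ℝ)
        (f := V) (φ := fderiv ℝ V (φp t)) (C := K₂ * ‖φq t - φp t‖) (fun x _ => hVd x)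
        (fun z hz => by
          refine (hK₂.norm_sub_le (hseg hz) hbp).trans ?_
          gcongr
          obtain ⟨a, ha, rfl⟩ := (segment_eq_image' ℝ (φp t) (φq t)) ▸ hz
          rw [add_sub_cancel_left, norm_smul, Real.norm_of_nonneg ha.1]
          exact mul_le_of_le_one_left (norm_nonneg _) ha.2)
        (left_mem_segment ℝ _ _) (right_mem_segment ℝ _ _)
      have hl := hlip q p hq' hp' t ht'
      have h1 : ‖fderiv ℝ V (φp t) (φq t - φp t - A t (q - p))‖
          ≤ K * ‖φq t - φp t - A t (q - p)‖ := ContinuousLinearMap.le_of_opNorm_le _ (hK _) _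
      have h2 : K₂ * ‖φq t - φp t‖ * ‖φq t - φp t‖ ≤ K₂ * (L₀ * ‖q - p‖) ^ 2 := by
        rw [mul_assoc, ← sq]
        gcongr
      calc _ = ‖(V (φq t) - V (φp t) - fderiv ℝ V (φp t) (φq t - φp t))
            + fderiv ℝ V (φp t) (φq t - φp t - A t (q - p))‖ := by
              congr 1; simp only [map_sub]; abel
        _ ≤ _ := (norm_add_le _ _).trans (by
          have := norm_nonneg (φq t - φp t - A t (q - p))
          linarith)
  · exact continuous_snd.comp ((hΨ.continuous_space hW hC hgW ht).comp (by fun_prop))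
end Flow

section Dominated
variable {ι : Type*}

lemma sum_sq_nonneg' (s : Finset ι) (v : ι → ℝ) : 0 ≤ ∑ i ∈ s, v i ^ 2 :=
  Finset.sum_nonneg fun _ _ => sq_nonneg _

lemma hasDerivAt_sum_sq {v v' : ℝ → ι → ℝ} (s : Finset ι) {t : ℝ}
    (h : HasDerivAt v (v' t) t) :
    HasDerivAt (fun t => ∑ i ∈ s, v t i ^ 2) (2 * ∑ i ∈ s, v t i * v' t i) t := by
  rw [Finset.mul_sum]
  refine HasDerivAt.fun_sum fun i _ => ?_
  exact ((hasDerivAt_pi.1 h i).pow 2).congr_deriv (by push_cast; ring)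

variable [Fintype ι]

/-- The vector field `V` contracts the coordinates in `s` at rate `β`, and its linearization expands
all vectors at rate at most `α < β`, hence dominated by the contraction. -/
structure IsDominated (V : (ι → ℝ) → ι → ℝ) (s : Finset ι) (α β C : ℝ) : Prop where
  lt : α < β
  rate_nonneg : 0 ≤ α
  nonneg : 0 ≤ C
  decay : ∀ p, ∑ i ∈ s, p i * V p i ≤ -β * ∑ i ∈ s, p i ^ 2
  growth : ∀ p v, ∑ i, v i * fderiv ℝ V p v i ≤ α * ∑ i, v i ^ 2
  normal : ∀ p v, ∑ i ∈ s, v i * fderiv ℝ V p v i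
    ≤ -β * ∑ i ∈ s, v i ^ 2 + C * (∑ i ∈ s, p i ^ 2) * ∑ i, v i ^ 2

/-- A `C¹` function which, together with its tangential derivatives, is controlled by the
coordinates in `s`. -/
structure IsTame (f : (ι → ℝ) → ℝ) (s : Finset ι) (c : ℝ) : Prop where
  contDiff : ContDiff ℝ 1 f
  nonneg : 0 ≤ c
  sq_le : ∀ p, f p ^ 2 ≤ c * ∑ i ∈ s, p i ^ 2
  fderiv_sq_le : ∀ p v, (fderiv ℝ f p v) ^ 2
    ≤ c * (∑ i ∈ s, v i ^ 2 + (∑ i ∈ s, p i ^ 2) * ∑ i, v i ^ 2)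

lemma le_exp_mul_of_deriv_le {g g' : ℝ → ℝ} {k : ℝ} (hg : ∀ t, HasDerivAt g (g' t) t)
    (h : ∀ t, 0 ≤ t → g' t ≤ -k * g t) {t : ℝ} (ht : 0 ≤ t) : g t ≤ Real.exp (-k * t) * g 0 := by
  have hd : ∀ t, HasDerivAt (fun t => Real.exp (k * t) * g t)
      (Real.exp (k * t) * k * g t + Real.exp (k * t) * g' t) t := fun t =>
    (by simpa using ((hasDerivAt_id t).const_mul k).exp : HasDerivAt (fun t => Real.exp (k * t))
      (Real.exp (k * t) * k) t).mul (hg t)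
  have hanti : AntitoneOn (fun t => Real.exp (k * t) * g t) (Ici 0) := by
    refine antitoneOn_of_deriv_nonpos (convex_Ici 0)
      (continuous_iff_continuousAt.2 fun t => (hd t).continuousAt).continuousOn
      (fun t _ => (hd t).differentiableAt.differentiableWithinAt) fun t ht => ?_
    rw [interior_Ici] at ht
    rw [(hd t).deriv]
    nlinarith [h t ht.le, Real.exp_pos (k * t)]
  have h1 := hanti (mem_Ici.2 le_rfl) (mem_Ici.2 ht) ht
  simp only [mul_zero, Real.exp_zero, one_mul] at h1
  calc g t = Real.exp (-k * t) * (Real.exp (k * t) * g t) := by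
        rw [← mul_assoc, ← Real.exp_add]; simp
    _ ≤ _ := by gcongr

namespace IsDominated

variable {V : (ι → ℝ) → ι → ℝ} {s : Finset ι} {α β C : ℝ} {Φ : ℝ → (ι → ℝ) → ι → ℝ}
  {L : ℝ → (ι → ℝ) → (ι → ℝ) →L[ℝ] (ι → ℝ)}

lemma sum_sq_flow_le (hD : IsDominated V s α β C) (hΦ : IsSmoothFlow V Φ L) (p : ι → ℝ) {t : ℝ}
    (ht : 0 ≤ t) :
    ∑ i ∈ s, Φ t p i ^ 2 ≤ Real.exp (-(2 * β) * t) * ∑ i ∈ s, p i ^ 2 := by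
  have := le_exp_mul_of_deriv_le (k := 2 * β)
    (fun t => hasDerivAt_sum_sq (v := fun t => Φ t p) (v' := fun t => V (Φ t p)) s (hΦ.deriv t p))
    (fun t _ => by linarith [hD.decay (Φ t p)]) ht
  simpa [hΦ.zero] using this

lemma fderiv_flow_le (hD : IsDominated V s α β C) (hΦ : IsSmoothFlow V Φ L) (p v : ι → ℝ) {t : ℝ}
    (ht : 0 ≤ t) :
    ∑ i ∈ s, L t p v i ^ 2 + (∑ i ∈ s, Φ t p i ^ 2) * ∑ i, L t p v i ^ 2
      ≤ Real.exp (-(β - α) * t) *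
        ((1 + (2 * C / (β - α) + 1) * ∑ i ∈ s, p i ^ 2) * ∑ i, v i ^ 2) := by
  have hlt := sub_pos.2 hD.lt
  have hC := hD.nonneg
  set M : ℝ := 2 * C / (β - α) + 1 with hM
  have hMC : (β - α) * M = 2 * C + (β - α) := by rw [hM]; field_simp
  have hM1 : 1 ≤ M := by rw [hM]; linarith [div_nonneg (mul_nonneg zero_le_two hC) hlt.le]
  have hv : ∀ t, HasDerivAt (fun t => L t p v) (fderiv ℝ V (Φ t p) (L t p v)) t := fun t =>
    ((hΦ.fderiv_deriv t p).clm_apply (hasDerivAt_const t v)).congr_deriv (by simp)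
  have key := le_exp_mul_of_deriv_le (k := β - α)
    (fun t => (hasDerivAt_sum_sq (v := fun t => L t p v)
        (v' := fun t => fderiv ℝ V (Φ t p) (L t p v)) s (hv t)).add
      (((hasDerivAt_sum_sq (v := fun t => Φ t p) (v' := fun t => V (Φ t p)) s
        (hΦ.deriv t p)).mul (hasDerivAt_sum_sq (v := fun t => L t p v)
        (v' := fun t => fderiv ℝ V (Φ t p) (L t p v)) Finset.univ (hv t))).const_mul M))
    (fun t _ => ?_) ht
  · simp only [Pi.add_apply, Pi.mul_apply, hΦ.zero, hΦ.fderiv_zero,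
      ContinuousLinearMap.id_apply] at key
    have h0 := mul_nonneg (sum_sq_nonneg' s (Φ t p)) (sum_sq_nonneg' Finset.univ (L t p v))
    refine le_trans (by nlinarith) (key.trans ?_)
    have h1 : ∑ i ∈ s, v i ^ 2 ≤ ∑ i, v i ^ 2 :=
      Finset.sum_le_univ_sum_of_nonneg fun _ => sq_nonneg _
    gcongr
    linarith
  · simp only [Pi.add_apply, Pi.mul_apply]
    have h1 := hD.decay (Φ t p)
    have h2 := hD.growth (Φ t p) (L t p v)
    have h3 := hD.normal (Φ t p) (L t p v)
    have hm := sum_sq_nonneg' s (Φ t p)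
    have hn := sum_sq_nonneg' Finset.univ (L t p v)
    have hmv := sum_sq_nonneg' s (L t p v)
    generalize ∑ i ∈ s, Φ t p i ^ 2 = m at *
    generalize ∑ i, L t p v i ^ 2 = n at *
    generalize ∑ i ∈ s, L t p v i ^ 2 = mv at *
    generalize ∑ i ∈ s, Φ t p i * V (Φ t p) i = a at *
    generalize ∑ i, L t p v i * fderiv ℝ V (Φ t p) (L t p v) i = b at *
    generalize ∑ i ∈ s, L t p v i * fderiv ℝ V (Φ t p) (L t p v) i = c at *
    have h4 : M * (2 * a * n + m * (2 * b)) ≤ M * (2 * (-β * m) * n + m * (2 * (α * n))) := by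
      gcongr
    have h5 : 0 ≤ (α + β) * mv := mul_nonneg (by linarith [hD.rate_nonneg]) hmv
    have h6 : 0 ≤ (β - α) * (m * n) := by positivity
    have h7 : (β - α) * M * (m * n) = (2 * C + (β - α)) * (m * n) := by rw [hMC]
    linarith

end IsDominated
end Dominated

section Integrals
variable {E : Type*} [NormedAddCommGroup E] [NormedSpace ℝ E]

lemma integrableOn_pow_mul_exp_neg (k : ℕ) {b : ℝ} (hb : 0 < b) :
    IntegrableOn (fun t : ℝ => t ^ k * Real.exp (-b * t)) (Ioi 0) := by
  simpa using integrableOn_rpow_mul_exp_neg_mul_rpow (s := k) (p := 1)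
    (by linarith [(Nat.cast_nonneg k : (0 : ℝ) ≤ k)]) one_pos hb

/-- Differentiation under the integral sign on `(0, ∞)` with a locally uniform domination. -/
lemma hasFDerivAt_integral_Ioi {F : ℝ → E → ℝ} {F' : ℝ → E → E →L[ℝ] ℝ} {A B : E → ℝ} {w : ℝ → ℝ}
    (hw : IntegrableOn w (Ioi 0)) (hw0 : ∀ t, 0 ≤ t → 0 ≤ w t)
    (hB : Continuous B)
    (hF : ∀ t, 0 ≤ t → ∀ p, HasFDerivAt (F t) (F' t p) p)
    (hF' : ∀ t, 0 ≤ t → Continuous (F' t))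
    (hFt : ∀ p, Continuous fun t => F t p) (hFt' : ∀ p, Continuous fun t => F' t p)
    (hFA : ∀ t, 0 ≤ t → ∀ p, ‖F t p‖ ≤ A p * w t) (hFB : ∀ t, 0 ≤ t → ∀ p, ‖F' t p‖ ≤ B p * w t) :
    (∀ p, IntegrableOn (fun t => F t p) (Ioi 0)) ∧ (∀ p, IntegrableOn (fun t => F' t p) (Ioi 0)) ∧
    (∀ p, HasFDerivAt (fun p => ∫ t in Ioi 0, F t p) (∫ t in Ioi 0, F' t p) p) ∧
    ContDiff ℝ 1 fun p => ∫ t in Ioi 0, F t p := by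
  have hae : ∀ {P : ℝ → Prop}, (∀ t, 0 ≤ t → P t) → ∀ᵐ t ∂volume.restrict (Ioi 0), P t :=
    fun h => (ae_restrict_mem measurableSet_Ioi).mono fun t ht => h t (le_of_lt ht)
  have hi : ∀ p, IntegrableOn (fun t => F t p) (Ioi 0) := fun p =>
    Integrable.mono' (hw.const_mul (A p)) (hFt p).aestronglyMeasurable
      (hae fun t ht => hFA t ht p)
  have hi' : ∀ p, IntegrableOn (fun t => F' t p) (Ioi 0) := fun p =>
    Integrable.mono' (hw.const_mul (B p)) (hFt' p).aestronglyMeasurable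
      (hae fun t ht => hFB t ht p)
  have hnhds : ∀ p, {q | B q < B p + 1} ∈ 𝓝 p := fun p =>
    hB.continuousAt.eventually_lt continuousAt_const (by simp)
  have hbd : ∀ p, ∀ t, 0 ≤ t → ∀ q ∈ {q | B q < B p + 1}, ‖F' t q‖ ≤ (B p + 1) * w t :=
    fun p t ht q hq => (hFB t ht q).trans (mul_le_mul_of_nonneg_right (le_of_lt hq) (hw0 t ht))
  have hd : ∀ p, HasFDerivAt (fun p => ∫ t in Ioi 0, F t p) (∫ t in Ioi 0, F' t p) p := fun p =>
    hasFDerivAt_integral_of_dominated_of_fderiv_le (F := fun p t => F t p)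
      (F' := fun p t => F' t p) (bound := fun t => (B p + 1) * w t) (hnhds p)
      (Eventually.of_forall fun q => (hFt q).aestronglyMeasurable) (hi p)
      (hFt' p).aestronglyMeasurable (hae (hbd p)) (hw.const_mul _)
      (hae fun t ht q _ => hF t ht q)
  refine ⟨hi, hi', hd, contDiff_one_iff_fderiv.2 ⟨fun p => (hd p).differentiableAt, ?_⟩⟩
  rw [show fderiv ℝ (fun p => ∫ t in Ioi 0, F t p) = fun p => ∫ t in Ioi 0, F' t p from
    funext fun p => (hd p).fderiv]
  exact continuous_iff_continuousAt.2 fun p =>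
    continuousAt_of_dominated (F := fun p t => F' t p) (bound := fun t => (B p + 1) * w t)
      (Eventually.of_forall fun q => (hFt' q).aestronglyMeasurable)
      (Filter.Eventually.mono (hnhds p) fun q hq => hae fun t ht => hbd p t ht q hq) (hw.const_mul _)
      (hae fun t ht => (hF' t ht).continuousAt)

end Integrals

section Tame
variable {ι : Type*} [Fintype ι]

/-- The moment `∫₀^∞ tᵏ f(Φ_t p) dt` of `f` along the forward orbit of `p`. -/
def flowMoment (Φ : ℝ → (ι → ℝ) → ι → ℝ) (k : ℕ) (f : (ι → ℝ) → ℝ) (p : ι → ℝ) : ℝ :=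
  ∫ t in Ioi 0, t ^ k * f (Φ t p)

lemma IsSmoothFlow.fderiv_apply_field {V : (ι → ℝ) → ι → ℝ} {Φ : ℝ → (ι → ℝ) → ι → ℝ}
    {L : ℝ → (ι → ℝ) → (ι → ℝ) →L[ℝ] (ι → ℝ)} (hV : ContDiff ℝ 1 V) (hΦ : IsSmoothFlow V Φ L)
    {t : ℝ} (ht : 0 ≤ t) (p : ι → ℝ) : L t p (V p) = V (Φ t p) := by
  have h1 : HasDerivAt (fun s => Φ t (Φ s p)) (L t p (V p)) 0 := by
    have h := hΦ.deriv 0 p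
    rw [hΦ.zero] at h
    exact (by rw [hΦ.zero]; exact hΦ.hasFDerivAt t ht p : HasFDerivAt (Φ t) (L t p)
      (Φ 0 p)).comp_hasDerivAt 0 h
  have h2 : HasDerivAt (fun s => Φ t (Φ s p)) (V (Φ t p)) 0 := by
    simp_rw [← hΦ.add hV]
    have h := hΦ.deriv (t + 0) p
    simpa using HasDerivAt.comp_const_add t 0 h
  exact h1.unique h2

namespace IsTame
variable {V : (ι → ℝ) → ι → ℝ} {s : Finset ι} {α β C c : ℝ} {Φ : ℝ → (ι → ℝ) → ι → ℝ}
  {L : ℝ → (ι → ℝ) → (ι → ℝ) →L[ℝ] (ι → ℝ)} {f : (ι → ℝ) → ℝ}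

lemma abs_flow_le (hf : IsTame f s c) (hD : IsDominated V s α β C) (hΦ : IsSmoothFlow V Φ L)
    {t : ℝ} (ht : 0 ≤ t) (p : ι → ℝ) :
    |f (Φ t p)| ≤ √(c * ∑ i ∈ s, p i ^ 2) * Real.exp (-((β - α) / 2) * t) := by
  have h0 : 0 ≤ c * ∑ i ∈ s, p i ^ 2 := mul_nonneg hf.nonneg (sum_sq_nonneg' s p)
  refine abs_le_of_sq_le_sq ?_ (by positivity)
  rw [mul_pow, Real.sq_sqrt h0, ← Real.exp_nat_mul]
  calc f (Φ t p) ^ 2 ≤ c * ∑ i ∈ s, Φ t p i ^ 2 := hf.sq_le _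
    _ ≤ c * (Real.exp (-(2 * β) * t) * ∑ i ∈ s, p i ^ 2) :=
        mul_le_mul_of_nonneg_left (hD.sum_sq_flow_le hΦ p ht) hf.nonneg
    _ = c * (∑ i ∈ s, p i ^ 2) * Real.exp (-(2 * β) * t) := by ring
    _ ≤ _ := by
        refine mul_le_mul_of_nonneg_left (Real.exp_le_exp.2 ?_) h0
        push_cast
        nlinarith [hD.lt, hD.rate_nonneg]

lemma norm_fderiv_flow_le (hf : IsTame f s c) (hD : IsDominated V s α β C)
    (hΦ : IsSmoothFlow V Φ L) {t : ℝ} (ht : 0 ≤ t) (p : ι → ℝ) :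
    ‖(fderiv ℝ f (Φ t p)).comp (L t p)‖ ≤
      √(c * ((1 + (2 * C / (β - α) + 1) * ∑ i ∈ s, p i ^ 2) * Fintype.card ι)) *
        Real.exp (-((β - α) / 2) * t) := by
  have hlt := sub_pos.2 hD.lt
  have hC := hD.nonneg
  have hc := hf.nonneg
  have hm := sum_sq_nonneg' s p
  have h0 : 0 ≤ c * ((1 + (2 * C / (β - α) + 1) * ∑ i ∈ s, p i ^ 2) * Fintype.card ι) := by
    positivity
  refine ContinuousLinearMap.opNorm_le_bound _ (by positivity) fun v => ?_
  rw [Real.norm_eq_abs, ContinuousLinearMap.comp_apply]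
  refine abs_le_of_sq_le_sq ?_ (by positivity)
  rw [mul_pow, mul_pow, Real.sq_sqrt h0, ← Real.exp_nat_mul]
  have hv : ∑ i, v i ^ 2 ≤ Fintype.card ι * ‖v‖ ^ 2 := by
    rw [← nsmul_eq_mul]
    refine Finset.sum_le_card_nsmul _ _ _ fun i _ => ?_
    rw [← sq_abs]
    exact pow_le_pow_left₀ (abs_nonneg _) (norm_le_pi_norm v i) 2
  calc _ ≤ c * _ := hf.fderiv_sq_le _ _
    _ ≤ c * _ := mul_le_mul_of_nonneg_left (hD.fderiv_flow_le hΦ p v ht) hc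
    _ ≤ c * (Real.exp (-(β - α) * t) *
        ((1 + (2 * C / (β - α) + 1) * ∑ i ∈ s, p i ^ 2) * (Fintype.card ι * ‖v‖ ^ 2))) := by
        gcongr
    _ = _ := by
        rw [show ((2 : ℕ) : ℝ) * (-((β - α) / 2) * t) = -(β - α) * t by push_cast; ring]
        ring

lemma integrals (hf : IsTame f s c) (hD : IsDominated V s α β C) (hΦ : IsSmoothFlow V Φ L)
    (k : ℕ) :
    (∀ p, IntegrableOn (fun t => t ^ k * f (Φ t p)) (Ioi 0)) ∧
    (∀ p, IntegrableOn (fun t => t ^ k • (fderiv ℝ f (Φ t p)).comp (L t p)) (Ioi 0)) ∧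
    (∀ p, HasFDerivAt (flowMoment Φ k f)
      (∫ t in Ioi 0, t ^ k • (fderiv ℝ f (Φ t p)).comp (L t p)) p) ∧
    ContDiff ℝ 1 (flowMoment Φ k f) := by
  have hb : 0 < (β - α) / 2 := by linarith [hD.lt]
  have hΦt : ∀ p, Continuous fun t => Φ t p := hΦ.continuous_time
  have hLt : ∀ p, Continuous fun t => L t p := fun p =>
    continuous_iff_continuousAt.2 fun t => (hΦ.fderiv_deriv t p).continuousAt
  have hΦp : ∀ t, 0 ≤ t → Continuous (Φ t) := fun t ht =>
    continuous_iff_continuousAt.2 fun p => (hΦ.hasFDerivAt t ht p).continuousAt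
  have hfd := hf.contDiff.continuous_fderiv one_ne_zero
  refine hasFDerivAt_integral_Ioi (F := fun t p => t ^ k * f (Φ t p))
    (F' := fun t p => t ^ k • (fderiv ℝ f (Φ t p)).comp (L t p))
    (A := fun p => √(c * ∑ i ∈ s, p i ^ 2))
    (B := fun p => √(c * ((1 + (2 * C / (β - α) + 1) * ∑ i ∈ s, p i ^ 2) * Fintype.card ι)))
    (integrableOn_pow_mul_exp_neg k hb) (fun t ht => by positivity) (by fun_prop)
    (fun t ht p => ?_) (fun t ht => ?_) (fun p => ?_) (fun p => ?_) (fun t ht p => ?_)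
    (fun t ht p => ?_)
  · exact (((hf.contDiff.differentiable one_ne_zero _).hasFDerivAt.comp p
      (hΦ.hasFDerivAt t ht p)).const_mul (t ^ k))
  · exact Continuous.const_smul ((hfd.comp (hΦp t ht)).clm_comp (hΦ.continuous_fderiv t ht)) (t ^ k)
  · exact (continuous_pow k).mul (hf.contDiff.continuous.comp (hΦt p))
  · exact (continuous_pow k).smul ((hfd.comp (hΦt p)).clm_comp (hLt p))
  · rw [norm_mul, norm_pow, Real.norm_of_nonneg ht, Real.norm_eq_abs, mul_left_comm]
    exact mul_le_mul_of_nonneg_left (hf.abs_flow_le hD hΦ ht p) (by positivity)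
  · rw [norm_smul, norm_pow, Real.norm_of_nonneg ht, mul_left_comm]
    exact mul_le_mul_of_nonneg_left (hf.norm_fderiv_flow_le hD hΦ ht p) (by positivity)

lemma contDiff_flowMoment (hf : IsTame f s c) (hD : IsDominated V s α β C)
    (hΦ : IsSmoothFlow V Φ L) (k : ℕ) : ContDiff ℝ 1 (flowMoment Φ k f) :=
  (hf.integrals hD hΦ k).2.2.2

lemma tendsto_pow_mul_flow (hf : IsTame f s c) (hD : IsDominated V s α β C)
    (hΦ : IsSmoothFlow V Φ L) (k : ℕ) (p : ι → ℝ) :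
    Tendsto (fun t => t ^ k * f (Φ t p)) atTop (𝓝 0) := by
  have hb : 0 < (β - α) / 2 := by linarith [hD.lt]
  have h := (tendsto_rpow_mul_exp_neg_mul_atTop_nhds_zero k _ hb).const_mul
    √(c * ∑ i ∈ s, p i ^ 2)
  rw [mul_zero] at h
  refine squeeze_zero_norm' ?_ h
  filter_upwards [eventually_ge_atTop 0] with t ht
  rw [norm_mul, norm_pow, Real.norm_of_nonneg ht, Real.norm_eq_abs, mul_left_comm, Real.rpow_natCast]
  exact mul_le_mul_of_nonneg_left (hf.abs_flow_le hD hΦ ht p) (by positivity)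

lemma fderiv_flowMoment_apply (hf : IsTame f s c) (hV : ContDiff ℝ 1 V)
    (hD : IsDominated V s α β C) (hΦ : IsSmoothFlow V Φ L) (k : ℕ) (p : ι → ℝ) :
    fderiv ℝ (flowMoment Φ k f) p (V p) =
      ∫ t in Ioi 0, t ^ k * fderiv ℝ f (Φ t p) (V (Φ t p)) := by
  obtain ⟨-, hi, hd, -⟩ := hf.integrals hD hΦ k
  rw [(hd p).fderiv, ContinuousLinearMap.integral_apply (hi p)]
  refine setIntegral_congr_fun measurableSet_Ioi fun t ht => ?_
  simp [hΦ.fderiv_apply_field hV (le_of_lt ht)]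

lemma integrableOn_fderiv (hf : IsTame f s c) (hV : ContDiff ℝ 1 V)
    (hD : IsDominated V s α β C) (hΦ : IsSmoothFlow V Φ L) (k : ℕ) (p : ι → ℝ) :
    IntegrableOn (fun t => t ^ k * fderiv ℝ f (Φ t p) (V (Φ t p))) (Ioi 0) := by
  refine (((ContinuousLinearMap.apply ℝ ℝ (V p)).integrable_comp
    ((hf.integrals hD hΦ k).2.1 p))).congr ?_
  refine (ae_restrict_mem measurableSet_Ioi).mono fun t ht => ?_
  simp [hΦ.fderiv_apply_field hV (le_of_lt ht)]

lemma hasDerivAt_flow (hf : ContDiff ℝ 1 f) (hΦ : IsSmoothFlow V Φ L) (p : ι → ℝ) (t : ℝ) :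
    HasDerivAt (fun t => f (Φ t p)) (fderiv ℝ f (Φ t p) (V (Φ t p))) t :=
  (hf.differentiable one_ne_zero _).hasFDerivAt.comp_hasDerivAt t (hΦ.deriv t p)

lemma fderiv_flowMoment_zero (hf : IsTame f s c) (hV : ContDiff ℝ 1 V)
    (hD : IsDominated V s α β C) (hΦ : IsSmoothFlow V Φ L) (p : ι → ℝ) :
    fderiv ℝ (flowMoment Φ 0 f) p (V p) = -f p := by
  rw [hf.fderiv_flowMoment_apply hV hD hΦ]
  have h1 := hf.integrableOn_fderiv hV hD hΦ 0 p
  have h2 := hf.tendsto_pow_mul_flow hD hΦ 0 p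
  simp only [pow_zero, one_mul] at h1 h2 ⊢
  rw [integral_Ioi_of_hasDerivAt_of_tendsto' (fun t _ => hasDerivAt_flow hf.contDiff hΦ p t) h1 h2,
    hΦ.zero, zero_sub]

lemma fderiv_flowMoment_one (hf : IsTame f s c) (hV : ContDiff ℝ 1 V)
    (hD : IsDominated V s α β C) (hΦ : IsSmoothFlow V Φ L) (p : ι → ℝ) :
    fderiv ℝ (flowMoment Φ 1 f) p (V p) = -flowMoment Φ 0 f p := by
  rw [hf.fderiv_flowMoment_apply hV hD hΦ, flowMoment]
  have h1 := hf.integrableOn_fderiv hV hD hΦ 1 p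
  have h2 := hf.tendsto_pow_mul_flow hD hΦ 1 p
  have h3 := (hf.integrals hD hΦ 0).1 p
  simp only [pow_zero, one_mul, pow_one] at h1 h2 h3 ⊢
  have h4 := integral_Ioi_of_hasDerivAt_of_tendsto'
    (fun t _ => (hasDerivAt_id t).mul (hasDerivAt_flow hf.contDiff hΦ p t))
    (by simpa using! h3.add h1) h2
  simp only [one_mul, id_eq, Pi.mul_apply, zero_mul, sub_zero] at h4
  rw [integral_add h3 h1] at h4
  linarith

lemma flowMoment_eq_zero (hf : IsTame f s c) (hD : IsDominated V s α β C)
    (hΦ : IsSmoothFlow V Φ L) (k : ℕ) {p : ι → ℝ} (hp : ∀ i ∈ s, p i = 0) :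
    flowMoment Φ k f p = 0 := by
  rw [flowMoment]
  refine setIntegral_eq_zero_of_forall_eq_zero fun t ht => ?_
  have h := hf.abs_flow_le hD hΦ (le_of_lt ht) p
  rw [Finset.sum_eq_zero fun i hi => by simp [hp i hi]] at h
  have : f (Φ t p) = 0 := by simpa using h
  simp [this]

lemma tendsto_of_fderiv_eq (hf : IsTame f s c) (hD : IsDominated V s α β C)
    (hΦ : IsSmoothFlow V Φ L) {g : (ι → ℝ) → ℝ} (hg : ContDiff ℝ 1 g)
    (hgf : ∀ p, fderiv ℝ g p (V p) = f p) (p : ι → ℝ) :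
    Tendsto (fun t => g (Φ t p)) atTop (𝓝 (g p + flowMoment Φ 0 f p)) := by
  have h3 := (hf.integrals hD hΦ 0).1 p
  have h4 := (intervalIntegral_tendsto_integral_Ioi 0 h3 tendsto_id).const_add (g p)
  refine h4.congr fun t => ?_
  have hd : ∀ t, HasDerivAt (fun t => g (Φ t p)) (f (Φ t p)) t := fun t =>
    (hasDerivAt_flow hg hΦ p t).congr_deriv (hgf _)
  simp only [pow_zero, one_mul, id_eq]
  rw [intervalIntegral.integral_eq_sub_of_hasDerivAt (fun t _ => hd t)
    ((hf.contDiff.continuous.comp (hΦ.continuous_time p)).intervalIntegrable _ _), hΦ.zero]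
  ring

end IsTame
end Tame

section Clamp

/-- A fixed smooth bump function on `ℝ`, equal to `1` on `[-1, 1]` and supported in `[-2, 2]`. -/
def clampBump : ContDiffBump (0 : ℝ) := ⟨1, 2, one_pos, one_lt_two⟩

/-- A smooth function with values in `[-2 * δ, 2 * δ]` which is the identity on `[-δ, δ]`. -/
def smoothClamp (δ s : ℝ) : ℝ := s * clampBump (s / δ)

variable {δ : ℝ}

lemma contDiff_smoothClamp (δ : ℝ) (n : ℕ∞) : ContDiff ℝ n (smoothClamp δ) :=
  contDiff_id.mul (clampBump.contDiff.comp (contDiff_id.div_const δ))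

lemma smoothClamp_of_abs_le (hδ : 0 < δ) {s : ℝ} (hs : |s| ≤ δ) : smoothClamp δ s = s := by
  have : clampBump (s / δ) = 1 := clampBump.one_of_mem_closedBall (by
    rw [mem_closedBall_zero_iff, Real.norm_eq_abs, abs_div, abs_of_pos hδ]
    exact (div_le_one hδ).2 hs)
  rw [smoothClamp, this, mul_one]

lemma smoothClamp_of_le_abs (hδ : 0 < δ) {s : ℝ} (hs : 2 * δ ≤ |s|) : smoothClamp δ s = 0 := by
  have : clampBump (s / δ) = 0 := clampBump.zero_of_le_dist (by
    rw [dist_zero_right, Real.norm_eq_abs, abs_div, abs_of_pos hδ]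
    exact (le_div_iff₀ hδ).2 hs)
  rw [smoothClamp, this, mul_zero]

lemma abs_smoothClamp_le_abs (δ s : ℝ) : |smoothClamp δ s| ≤ |s| := by
  rw [smoothClamp, abs_mul, abs_of_nonneg (clampBump.nonneg' _)]
  exact mul_le_of_le_one_right (abs_nonneg _) clampBump.le_one

lemma abs_smoothClamp_le (hδ : 0 < δ) (s : ℝ) : |smoothClamp δ s| ≤ 2 * δ := by
  rcases le_total (2 * δ) |s| with h | h
  · rw [smoothClamp_of_le_abs hδ h, abs_zero]
    positivity
  · exact (abs_smoothClamp_le_abs δ s).trans h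

lemma exists_abs_deriv_smoothClamp_le :
    ∃ K : ℝ, 1 ≤ K ∧ ∀ δ s, 0 < δ → |deriv (smoothClamp δ) s| ≤ K := by
  have hc : HasCompactSupport (deriv clampBump) := clampBump.hasCompactSupport.deriv
  have hcont : Continuous (deriv clampBump) :=
    (clampBump.contDiff (n := 1)).continuous_deriv le_rfl
  obtain ⟨M, hM⟩ := (hc.mul_left (f := fun x : ℝ => x)).exists_bound_of_continuous
    (continuous_id.mul hcont)
  refine ⟨1 + |M|, by linarith [abs_nonneg M], fun δ s hδ => ?_⟩
  have hb : HasDerivAt clampBump (deriv clampBump (s / δ)) (s / δ) :=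
    ((clampBump.contDiff (n := 1)).differentiable one_ne_zero _).hasDerivAt
  have hd : HasDerivAt (smoothClamp δ)
      (1 * clampBump (s / δ) + s * (deriv clampBump (s / δ) * (1 / δ))) s :=
    (hasDerivAt_id s).mul
      (HasDerivAt.comp (h₂ := clampBump) (h := fun s => s / δ) s hb ((hasDerivAt_id s).div_const δ))
  rw [hd.deriv, one_mul]
  have h1 : |clampBump (s / δ)| ≤ 1 := by
    rw [abs_of_nonneg (clampBump.nonneg' _)]
    exact clampBump.le_one
  have h2 : |s * (deriv clampBump (s / δ) * (1 / δ))| ≤ |M| := by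
    have := hM (s / δ)
    rw [show s * (deriv clampBump (s / δ) * (1 / δ)) = s / δ * deriv clampBump (s / δ) by ring]
    exact this.trans (le_abs_self M)
  exact (abs_add_le _ _).trans (add_le_add h1 h2)

variable {ι : Type*} [Fintype ι]

/-- `smoothClamp` applied to each coordinate. -/
def clampVec (δ : ℝ) (p : ι → ℝ) : ι → ℝ := fun i => smoothClamp δ (p i)

lemma contDiff_clampVec (δ : ℝ) (n : ℕ∞) : ContDiff ℝ n (clampVec δ : (ι → ℝ) → ι → ℝ) :=
  contDiff_pi.2 fun i => (contDiff_smoothClamp δ n).comp (contDiff_apply ℝ ℝ i)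

lemma hasDerivAt_smoothClamp (δ s : ℝ) :
    HasDerivAt (smoothClamp δ) (deriv (smoothClamp δ) s) s :=
  ((contDiff_smoothClamp δ 1).differentiable one_ne_zero s).hasDerivAt

lemma fderiv_clampVec_apply (δ : ℝ) (p v : ι → ℝ) (i : ι) :
    fderiv ℝ (clampVec δ) p v i = deriv (smoothClamp δ) (p i) * v i := by
  have h : HasFDerivAt (clampVec δ : (ι → ℝ) → ι → ℝ)
      (ContinuousLinearMap.pi fun i => deriv (smoothClamp δ) (p i) •
        (ContinuousLinearMap.proj i : (ι → ℝ) →L[ℝ] ℝ)) p :=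
    hasFDerivAt_pi.2 fun i => (hasDerivAt_smoothClamp δ (p i)).comp_hasFDerivAt p
      (ContinuousLinearMap.proj i : (ι → ℝ) →L[ℝ] ℝ).hasFDerivAt
  simp [h.fderiv]

lemma norm_clampVec_le (hδ : 0 < δ) (p : ι → ℝ) : ‖clampVec δ p‖ ≤ 2 * δ :=
  (pi_norm_le_iff_of_nonneg (by positivity)).2 fun i => abs_smoothClamp_le hδ (p i)

lemma clampVec_eventuallyEq (hδ : 0 < δ) : ∀ᶠ p : ι → ℝ in 𝓝 0, clampVec δ p = p := by
  filter_upwards [closedBall_mem_nhds (0 : ι → ℝ) hδ] with p hp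
  rw [mem_closedBall_zero_iff] at hp
  exact funext fun i => smoothClamp_of_abs_le hδ ((norm_le_pi_norm p i).trans hp)

end Clamp

section NearZero
variable {E : Type*} [NormedAddCommGroup E] [NormedSpace ℝ E]

/-- Quantitative `C²` control of `f` on the ball of radius `R` around `0`. -/
structure IsC2Near (f : E → ℝ) (R B : ℝ) : Prop where
  contDiffAt : ∀ q ∈ ball (0 : E) R, ContDiffAt ℝ 2 f q
  norm_fderiv_le : ∀ q ∈ ball (0 : E) R, ‖fderiv ℝ f q‖ ≤ B
  abs_sub_le : ∀ q ∈ ball (0 : E) R, ∀ q' ∈ ball (0 : E) R, |f q - f q'| ≤ B * ‖q - q'‖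
  fderiv_sub_le : ∀ q ∈ ball (0 : E) R, ∀ q' ∈ ball (0 : E) R,
    ‖fderiv ℝ f q - fderiv ℝ f q'‖ ≤ B * ‖q - q'‖

lemma IsC2Near.mono {f : E → ℝ} {R B R' B' : ℝ} (h : IsC2Near f R B) (hR : R' ≤ R) (hB : B ≤ B') :
    IsC2Near f R' B' := by
  have hs := ball_subset_ball (x := (0 : E)) hR
  exact ⟨fun q hq => h.1 q (hs hq), fun q hq => (h.2 q (hs hq)).trans hB,
    fun q hq q' hq' => (h.3 q (hs hq) q' (hs hq')).trans
      (mul_le_mul_of_nonneg_right hB (norm_nonneg _)),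
    fun q hq q' hq' => (h.4 q (hs hq) q' (hs hq')).trans
      (mul_le_mul_of_nonneg_right hB (norm_nonneg _))⟩

lemma ContDiffAt.exists_isC2Near {f : E → ℝ} (hf : ContDiffAt ℝ 2 f 0) :
    ∃ R > 0, ∃ B, 0 ≤ B ∧ IsC2Near f R B := by
  obtain ⟨K₁, s₁, hs₁, h₁⟩ := (hf.of_le one_le_two).exists_lipschitzOnWith
  obtain ⟨K₂, s₂, hs₂, h₂⟩ := (hf.fderiv_right (m := 1)
    (by norm_num [one_add_one_eq_two])).exists_lipschitzOnWith
  obtain ⟨R, hR, hb⟩ := Metric.mem_nhds_iff.1 (inter_mem (inter_mem hs₁ hs₂)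
    (hf.eventually (by simp)))
  have hb₁ : ball (0 : E) R ⊆ s₁ := fun q hq => (hb hq).1.1
  have hb₂ : ball (0 : E) R ⊆ s₂ := fun q hq => (hb hq).1.2
  refine ⟨R, hR, max K₁ K₂, le_max_of_le_left K₁.2, fun q hq => (hb hq).2, fun q hq => ?_,
    fun q hq q' hq' => ?_, fun q hq q' hq' => ?_⟩
  · exact (norm_fderiv_le_of_lipschitzOn ℝ (mem_of_superset (isOpen_ball.mem_nhds hq) hb₁)
      h₁).trans (le_max_left _ _)
  · exact (h₁.norm_sub_le (hb₁ hq) (hb₁ hq')).trans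
      (mul_le_mul_of_nonneg_right (le_max_left _ _) (norm_nonneg _))
  · exact (h₂.norm_sub_le (hb₂ hq) (hb₂ hq')).trans
      (mul_le_mul_of_nonneg_right (le_max_right _ _) (norm_nonneg _))

end NearZero

section ClampComp
variable {ι : Type*} [Fintype ι] {f : (ι → ℝ) → ℝ} {R B δ : ℝ}

lemma norm_sq_le_sum_sq (v : ι → ℝ) : ‖v‖ ^ 2 ≤ ∑ i, v i ^ 2 := by
  have : ‖v‖ ≤ √(∑ i, v i ^ 2) := (pi_norm_le_iff_of_nonneg (Real.sqrt_nonneg _)).2 fun i =>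
    Real.abs_le_sqrt (Finset.single_le_sum (f := fun i => v i ^ 2) (fun _ _ => sq_nonneg _)
      (Finset.mem_univ i))
  exact (pow_le_pow_left₀ (norm_nonneg _) this 2).trans_eq
    (Real.sq_sqrt (sum_sq_nonneg' _ _))

lemma clampVec_mem_ball (hδ : 0 < δ) (hR : 2 * δ < R) (p : ι → ℝ) :
    clampVec δ p ∈ ball (0 : ι → ℝ) R :=
  mem_ball_zero_iff.2 ((norm_clampVec_le hδ p).trans_lt hR)

lemma IsC2Near.contDiff_comp (h : IsC2Near f R B) (hδ : 0 < δ) (hR : 2 * δ < R) :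
    ContDiff ℝ 2 fun p => f (clampVec δ p) :=
  contDiff_iff_contDiffAt.2 fun p => (h.contDiffAt _ (clampVec_mem_ball hδ hR p)).comp p
    (contDiff_clampVec δ 2).contDiffAt

lemma IsC2Near.fderiv_comp (h : IsC2Near f R B) (hδ : 0 < δ) (hR : 2 * δ < R) (p v : ι → ℝ) :
    fderiv ℝ (fun p => f (clampVec δ p)) p v =
      fderiv ℝ f (clampVec δ p) fun i => deriv (smoothClamp δ) (p i) * v i := by
  have h1 := ((h.contDiffAt _ (clampVec_mem_ball hδ hR p)).differentiableAt
    two_ne_zero).hasFDerivAt.comp p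
    (((contDiff_clampVec δ 1).differentiable one_ne_zero p).hasFDerivAt)
  rw [HasFDerivAt.fderiv (f := fun p => f (clampVec δ p)) h1, ContinuousLinearMap.comp_apply]
  congr 1
  exact funext fun i => fderiv_clampVec_apply δ p v i

lemma norm_deriv_mul_le {K : ℝ} (hK : ∀ δ s, 0 < δ → |deriv (smoothClamp δ) s| ≤ K) (hδ : 0 < δ)
    (p v : ι → ℝ) : ‖fun i => deriv (smoothClamp δ) (p i) * v i‖ ≤ K * ‖v‖ := by
  have hK0 : 0 ≤ K := (abs_nonneg _).trans (hK δ 0 hδ)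
  refine (pi_norm_le_iff_of_nonneg (by positivity)).2 fun i => ?_
  rw [norm_mul]
  exact mul_le_mul (hK δ _ hδ) (norm_le_pi_norm v i) (norm_nonneg _) hK0

lemma IsTame.mul {f g : (ι → ℝ) → ℝ} {s : Finset ι} {c : ℝ} (hf : IsTame f s c)
    (hg : ContDiff ℝ 1 g) {M : ℝ} (hgM : ∀ p, |g p| ≤ M) (hgM' : ∀ p, ‖fderiv ℝ g p‖ ≤ M) :
    IsTame (fun p => g p * f p) s (2 * M ^ 2 * (c * (Fintype.card ι + 1))) := by
  have hc := hf.nonneg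
  have hM : 0 ≤ M := (abs_nonneg _).trans (hgM 0)
  have hg2 : ∀ p, g p ^ 2 ≤ M ^ 2 := fun p => sq_le_sq' (abs_le.1 (hgM p)).1 (abs_le.1 (hgM p)).2
  refine ⟨hg.mul hf.contDiff, by positivity, fun p => ?_, fun p v => ?_⟩
  · have h1 := hf.sq_le p
    have hm := sum_sq_nonneg' s p
    rw [mul_pow]
    calc g p ^ 2 * f p ^ 2 ≤ M ^ 2 * (c * ∑ i ∈ s, p i ^ 2) :=
          mul_le_mul (hg2 p) h1 (sq_nonneg _) (sq_nonneg _)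
      _ ≤ _ := by
          have : (0 : ℝ) ≤ M ^ 2 * (c * ∑ i ∈ s, p i ^ 2) := by positivity
          have h0 : (0 : ℝ) ≤ Fintype.card ι := Nat.cast_nonneg _
          nlinarith [mul_nonneg this h0]
  · have hd : fderiv ℝ (fun p => g p * f p) p v = g p * fderiv ℝ f p v + f p * fderiv ℝ g p v := by
      rw [fderiv_fun_mul (hg.differentiable one_ne_zero p)
        (hf.contDiff.differentiable one_ne_zero p)]
      simp
    have h1 := hf.fderiv_sq_le p v
    have h2 := hf.sq_le p
    have hv := norm_sq_le_sum_sq v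
    have h3 : (fderiv ℝ g p v) ^ 2 ≤ M ^ 2 * ∑ i, v i ^ 2 := by
      have := ((fderiv ℝ g p).le_opNorm v).trans
        (mul_le_mul_of_nonneg_right (hgM' p) (norm_nonneg v))
      calc _ = ‖fderiv ℝ g p v‖ ^ 2 := (sq_abs _).symm
        _ ≤ (M * ‖v‖) ^ 2 := pow_le_pow_left₀ (norm_nonneg _) this 2
        _ = M ^ 2 * ‖v‖ ^ 2 := by ring
        _ ≤ _ := by gcongr
    have hm := sum_sq_nonneg' s p
    have hn := sum_sq_nonneg' Finset.univ v
    have hmv := sum_sq_nonneg' s v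
    rw [hd]
    have h4 : (g p * fderiv ℝ f p v) ^ 2 ≤
        M ^ 2 * (c * (∑ i ∈ s, v i ^ 2 + (∑ i ∈ s, p i ^ 2) * ∑ i, v i ^ 2)) := by
      rw [mul_pow]
      exact mul_le_mul (hg2 p) h1 (sq_nonneg _) (sq_nonneg _)
    have h5 : (f p * fderiv ℝ g p v) ^ 2 ≤
        (c * ∑ i ∈ s, p i ^ 2) * (M ^ 2 * ∑ i, v i ^ 2) := by
      rw [mul_pow]
      exact mul_le_mul h2 h3 (sq_nonneg _) (by positivity)
    by_cases hι : Nonempty ι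
    · have h6 : (1 : ℝ) ≤ Fintype.card ι := by exact_mod_cast Fintype.card_pos
      have h7 : 0 ≤ M ^ 2 * (c * (∑ i ∈ s, v i ^ 2 + (∑ i ∈ s, p i ^ 2) * ∑ i, v i ^ 2)) := by
        positivity
      have h8 : 0 ≤ M ^ 2 * (c * (∑ i ∈ s, v i ^ 2)) := by positivity
      nlinarith [sq_nonneg (g p * fderiv ℝ f p v - f p * fderiv ℝ g p v),
        mul_nonneg h7 (sub_nonneg.2 h6)]
    · rw [not_nonempty_iff] at hι
      have h0 : v = 0 := Subsingleton.elim _ _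
      subst h0
      simp

end ClampComp

section ClampTame
variable {ι : Type*} [Fintype ι] {f : (ι → ℝ) → ℝ} {R B δ : ℝ}

lemma norm_indicator_sq_le [DecidableEq ι] (s : Finset ι) (v : ι → ℝ) :
    ‖fun i => if i ∈ s then v i else 0‖ ^ 2 ≤ ∑ i ∈ s, v i ^ 2 := by
  refine (norm_sq_le_sum_sq _).trans_eq ?_
  rw [← Finset.sum_filter_add_sum_filter_not Finset.univ (· ∈ s)]
  rw [Finset.sum_congr rfl (g := fun i => v i ^ 2) fun i hi => by
      rw [if_pos (Finset.mem_filter.1 hi).2],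
    Finset.sum_eq_zero (s := Finset.univ.filter (· ∉ s)) fun i hi => by
      rw [if_neg (Finset.mem_filter.1 hi).2, zero_pow two_ne_zero], add_zero,
    Finset.filter_mem_eq_inter, Finset.univ_inter]

/-- A function which is `C²` near `0` and vanishes where the coordinates in `s` vanish
becomes tame after clamping its arguments. -/
lemma IsC2Near.isTame_comp [DecidableEq ι] (h : IsC2Near f R B) (hB : 0 ≤ B) {s : Finset ι}
    (hf : ∀ q ∈ ball (0 : ι → ℝ) R, (∀ i ∈ s, q i = 0) → f q = 0) {K : ℝ} (hK1 : 1 ≤ K)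
    (hK : ∀ δ s, 0 < δ → |deriv (smoothClamp δ) s| ≤ K) (hδ : 0 < δ) (hR : 2 * δ < R) :
    IsTame (fun p => f (clampVec δ p)) s (2 * (B * K) ^ 2) := by
  set P : (ι → ℝ) → ι → ℝ := fun q i => if i ∈ s then 0 else q i with hP
  have hPq : ∀ q ∈ ball (0 : ι → ℝ) R, P q ∈ ball (0 : ι → ℝ) R := fun q hq => by
    rw [mem_ball_zero_iff] at hq ⊢
    refine lt_of_le_of_lt ((pi_norm_le_iff_of_nonneg (norm_nonneg _)).2 fun i => ?_) hq
    simp only [hP]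
    split_ifs
    · simp
    · exact norm_le_pi_norm q i
  have hsub : ∀ q, q - P q = fun i => if i ∈ s then q i else 0 := fun q => funext fun i => by
    simp only [hP, Pi.sub_apply]
    split_ifs <;> simp
  have hPs : ∀ q, ∀ i ∈ s, P q i = 0 := fun q i hi => if_pos hi
  have hdist : ∀ p, ‖clampVec δ p - P (clampVec δ p)‖ ^ 2 ≤ ∑ i ∈ s, p i ^ 2 := fun p => by
    rw [hsub]
    refine (norm_indicator_sq_le s _).trans (Finset.sum_le_sum fun i _ => ?_)
    exact sq_le_sq.2 (abs_smoothClamp_le_abs δ (p i))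
  refine ⟨(h.contDiff_comp hδ hR).of_le one_le_two, by positivity, fun p => ?_, fun p v => ?_⟩
  · have hq := clampVec_mem_ball hδ hR p
    have h1 := h.abs_sub_le _ hq _ (hPq _ hq)
    rw [hf _ (hPq _ hq) (hPs _), sub_zero] at h1
    calc f (clampVec δ p) ^ 2 = |f (clampVec δ p)| ^ 2 := (sq_abs _).symm
      _ ≤ (B * ‖clampVec δ p - P (clampVec δ p)‖) ^ 2 := pow_le_pow_left₀ (abs_nonneg _) h1 2
      _ = B ^ 2 * ‖clampVec δ p - P (clampVec δ p)‖ ^ 2 := by ring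
      _ ≤ B ^ 2 * ∑ i ∈ s, p i ^ 2 := by
          gcongr
          exact hdist p
      _ ≤ _ := by
          refine mul_le_mul_of_nonneg_right ?_ (sum_sq_nonneg' s p)
          nlinarith [mul_nonneg (sq_nonneg B) (by nlinarith : (0 : ℝ) ≤ K ^ 2 - 1), sq_nonneg B]
  · have hq := clampVec_mem_ball hδ hR p
    rw [h.fderiv_comp hδ hR]
    set q := clampVec δ p
    set w : ι → ℝ := fun i => deriv (smoothClamp δ) (p i) * v i with hw
    have hw1 : ‖w‖ ^ 2 ≤ K ^ 2 * ∑ i, v i ^ 2 := by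
      refine (pow_le_pow_left₀ (norm_nonneg _) (norm_deriv_mul_le hK hδ p v) 2).trans ?_
      rw [mul_pow]
      exact mul_le_mul_of_nonneg_left (norm_sq_le_sum_sq v) (sq_nonneg _)
    have hw2 : ‖w - P w‖ ^ 2 ≤ K ^ 2 * ∑ i ∈ s, v i ^ 2 := by
      rw [hsub, Finset.mul_sum]
      refine (norm_indicator_sq_le s _).trans (Finset.sum_le_sum fun i _ => ?_)
      rw [hw, mul_pow]
      refine mul_le_mul_of_nonneg_right ?_ (sq_nonneg _)
      rw [← sq_abs]
      exact pow_le_pow_left₀ (abs_nonneg _) (hK δ _ hδ) 2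
    have hz : fderiv ℝ f (P q) (P w) = 0 := by
      have hl : HasDerivAt (fun t : ℝ => P q + t • P w) (P w) 0 := by
        simpa using ((hasDerivAt_id (0 : ℝ)).smul_const (P w)).const_add (P q)
      have hd := HasFDerivAt.comp_hasDerivAt (0 : ℝ) (f := fun t : ℝ => P q + t • P w) (l := f)
        (l' := fderiv ℝ f (P q)) (by
          simpa using ((h.contDiffAt _ (hPq q hq)).differentiableAt two_ne_zero).hasFDerivAt) hl
      refine hd.unique ((hasDerivAt_const (0 : ℝ) (0 : ℝ)).congr_of_eventuallyEq ?_)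
      have hmem : ∀ᶠ t : ℝ in 𝓝 0, P q + t • P w ∈ ball (0 : ι → ℝ) R :=
        hl.continuousAt.eventually_mem (by simpa using isOpen_ball.mem_nhds (hPq q hq))
      filter_upwards [hmem] with t ht
      exact hf _ ht fun i hi => by simp [hPs _ i hi]
    have h1 : |fderiv ℝ f q w| ≤ B * ‖w - P w‖ + B * ‖q - P q‖ * ‖w‖ := by
      have e : fderiv ℝ f q w = fderiv ℝ f q (w - P w) +
          (fderiv ℝ f q - fderiv ℝ f (P q)) (P w) := by
        simp [hz]
      rw [e]
      refine (abs_add_le _ _).trans (add_le_add ?_ ?_)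
      · exact ((fderiv ℝ f q).le_opNorm _).trans
          (mul_le_mul_of_nonneg_right (h.norm_fderiv_le q hq) (norm_nonneg _))
      · refine ((fderiv ℝ f q - fderiv ℝ f (P q)).le_opNorm _).trans
          (mul_le_mul (h.fderiv_sub_le q hq _ (hPq q hq)) ?_ (norm_nonneg _) (by positivity))
        refine (pi_norm_le_iff_of_nonneg (norm_nonneg _)).2 fun i => ?_
        simp only [hP]
        split_ifs
        · simp
        · exact norm_le_pi_norm w i
    calc fderiv ℝ f q w ^ 2 = |fderiv ℝ f q w| ^ 2 := (sq_abs _).symm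
      _ ≤ (B * ‖w - P w‖ + B * ‖q - P q‖ * ‖w‖) ^ 2 := pow_le_pow_left₀ (abs_nonneg _) h1 2
      _ ≤ 2 * (B * ‖w - P w‖) ^ 2 + 2 * (B * ‖q - P q‖ * ‖w‖) ^ 2 := by
          nlinarith [sq_nonneg (B * ‖w - P w‖ - B * ‖q - P q‖ * ‖w‖)]
      _ = 2 * B ^ 2 * ‖w - P w‖ ^ 2 + 2 * B ^ 2 * (‖q - P q‖ ^ 2 * ‖w‖ ^ 2) := by ring
      _ ≤ 2 * B ^ 2 * (K ^ 2 * ∑ i ∈ s, v i ^ 2) +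
          2 * B ^ 2 * ((∑ i ∈ s, p i ^ 2) * (K ^ 2 * ∑ i, v i ^ 2)) := by
          have := hdist p
          have := sum_sq_nonneg' s p
          gcongr
      _ = _ := by ring

end ClampTame

section ClampField
variable {ι : Type*} [Fintype ι] {r : (ι → ℝ) → ℝ} {R B δ K ε : ℝ}

lemma IsC2Near.abs_comp_le (h : IsC2Near r R B) (hB : 0 ≤ B) (hr : r 0 = 0) (hδ : 0 < δ)
    (hR : 2 * δ < R) (p : ι → ℝ) : |r (clampVec δ p)| ≤ 2 * B * δ := by
  have h1 := h.abs_sub_le _ (clampVec_mem_ball hδ hR p) 0 (mem_ball_self (by linarith))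
  rw [hr, sub_zero, sub_zero] at h1
  calc _ ≤ _ := h1
    _ ≤ B * (2 * δ) := mul_le_mul_of_nonneg_left (norm_clampVec_le hδ p) hB
    _ = _ := by ring

lemma IsC2Near.abs_fderiv_comp_le (h : IsC2Near r R B) (hB : 0 ≤ B)
    (hK : ∀ δ s, 0 < δ → |deriv (smoothClamp δ) s| ≤ K) (hδ : 0 < δ)
    (hR : 2 * δ < R) (p v : ι → ℝ) :
    |fderiv ℝ (fun p => r (clampVec δ p)) p v| ≤ B * K * ‖v‖ := by
  rw [h.fderiv_comp hδ hR, mul_assoc]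
  exact ((fderiv ℝ r _).le_opNorm _).trans (mul_le_mul (h.norm_fderiv_le _
    (clampVec_mem_ball hδ hR p)) (norm_deriv_mul_le hK hδ p v) (norm_nonneg _) hB)

lemma IsC2Near.abs_fderiv_comp_le_of_fderiv_eq_zero (h : IsC2Near r R B) (hB : 0 ≤ B)
    (hr : fderiv ℝ r 0 = 0) (hK : ∀ δ s, 0 < δ → |deriv (smoothClamp δ) s| ≤ K) (hδ : 0 < δ)
    (hR : 2 * δ < R) (p v : ι → ℝ) :
    |fderiv ℝ (fun p => r (clampVec δ p)) p v| ≤ 2 * B * K * δ * ‖v‖ := by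
  rw [h.fderiv_comp hδ hR]
  have h1 := h.fderiv_sub_le _ (clampVec_mem_ball hδ hR p) 0 (mem_ball_self (by linarith))
  rw [hr, sub_zero, sub_zero] at h1
  calc _ ≤ _ := (fderiv ℝ r _).le_opNorm _
    _ ≤ (B * (2 * δ)) * (K * ‖v‖) :=
      mul_le_mul (h1.trans (mul_le_mul_of_nonneg_left (norm_clampVec_le hδ p) hB))
        (norm_deriv_mul_le hK hδ p v) (norm_nonneg _) (by positivity)
    _ = _ := by ring

lemma IsC2Near.contDiff_clamp_mul (h : IsC2Near r R B) (hδ : 0 < δ) (hR : 2 * δ < R) (i : ι) :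
    ContDiff ℝ 2 fun p : ι → ℝ => smoothClamp δ (p i) * r (clampVec δ p) :=
  ((contDiff_smoothClamp δ 2).comp (contDiff_apply ℝ ℝ i)).mul (h.contDiff_comp hδ hR)

lemma IsC2Near.fderiv_clamp_mul (h : IsC2Near r R B) (hδ : 0 < δ) (hR : 2 * δ < R) (i : ι)
    (p v : ι → ℝ) :
    fderiv ℝ (fun p : ι → ℝ => smoothClamp δ (p i) * r (clampVec δ p)) p v =
      deriv (smoothClamp δ) (p i) * v i * r (clampVec δ p) +
        smoothClamp δ (p i) * fderiv ℝ (fun p => r (clampVec δ p)) p v := by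
  have h1 : HasFDerivAt (fun p : ι → ℝ => smoothClamp δ (p i))
      (deriv (smoothClamp δ) (p i) • (ContinuousLinearMap.proj i : (ι → ℝ) →L[ℝ] ℝ)) p :=
    HasDerivAt.comp_hasFDerivAt (f := fun p : ι → ℝ => p i) p (hasDerivAt_smoothClamp δ (p i))
      (ContinuousLinearMap.proj i : (ι → ℝ) →L[ℝ] ℝ).hasFDerivAt
  have h2 := ((h.contDiff_comp hδ hR).differentiable two_ne_zero p).hasFDerivAt
  rw [(h1.fun_mul h2).fderiv]
  simp
  ring

lemma IsC2Near.abs_fderiv_clamp_mul_le (h : IsC2Near r R B) (hB : 0 ≤ B) (hr : r 0 = 0)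
    (hK : ∀ δ s, 0 < δ → |deriv (smoothClamp δ) s| ≤ K) (hδ : 0 < δ)
    (hR : 2 * δ < R) (i : ι) (p v : ι → ℝ) :
    |fderiv ℝ (fun p : ι → ℝ => smoothClamp δ (p i) * r (clampVec δ p)) p v| ≤
      4 * B * K * δ * ‖v‖ := by
  have hK0 : 0 ≤ K := (abs_nonneg _).trans (hK δ 0 hδ)
  rw [h.fderiv_clamp_mul hδ hR]
  refine (abs_add_le _ _).trans ?_
  rw [abs_mul, abs_mul, abs_mul]
  calc _ ≤ K * ‖v‖ * (2 * B * δ) + 2 * δ * (B * K * ‖v‖) :=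
      add_le_add (mul_le_mul (mul_le_mul (hK δ _ hδ) (norm_le_pi_norm v i) (abs_nonneg _) hK0)
          (h.abs_comp_le hB hr hδ hR p) (abs_nonneg _) (by positivity))
        (mul_le_mul (abs_smoothClamp_le hδ _) (h.abs_fderiv_comp_le hB hK hδ hR p v)
          (abs_nonneg _) (by positivity))
    _ = _ := by ring

lemma IsC2Near.mul_clamp_mul_le (h : IsC2Near r R B) (hB : 0 ≤ B) (hr : r 0 = 0) (hδ : 0 < δ)
    (hR : 2 * δ < R) (i : ι) (p : ι → ℝ) :
    p i * (smoothClamp δ (p i) * r (clampVec δ p)) ≤ 2 * B * δ * p i ^ 2 := by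
  refine (le_abs_self _).trans ?_
  rw [abs_mul, abs_mul, ← mul_assoc, mul_comm (2 * B * δ), ← sq_abs, sq]
  exact mul_le_mul (mul_le_mul_of_nonneg_left (abs_smoothClamp_le_abs δ _) (abs_nonneg _))
    (h.abs_comp_le hB hr hδ hR p) (abs_nonneg _) (by positivity)

lemma IsC2Near.mul_fderiv_clamp_mul_le (h : IsC2Near r R B) (hB : 0 ≤ B) (hr : r 0 = 0)
    (hK : ∀ δ s, 0 < δ → |deriv (smoothClamp δ) s| ≤ K) (hδ : 0 < δ)
    (hR : 2 * δ < R) (hε : 0 < ε) (hεδ : 2 * B * K * δ ≤ ε) (i : ι) (p v : ι → ℝ) :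
    v i * fderiv ℝ (fun p : ι → ℝ => smoothClamp δ (p i) * r (clampVec δ p)) p v ≤
      2 * ε * v i ^ 2 + (B * K) ^ 2 / (4 * ε) * p i ^ 2 * ∑ j, v j ^ 2 := by
  have hK0 : 0 ≤ K := (abs_nonneg _).trans (hK δ 0 hδ)
  rw [h.fderiv_clamp_mul hδ hR, mul_add]
  have h1 : v i * (deriv (smoothClamp δ) (p i) * v i * r (clampVec δ p)) ≤ ε * v i ^ 2 := by
    rw [show v i * (deriv (smoothClamp δ) (p i) * v i * r (clampVec δ p)) =
      deriv (smoothClamp δ) (p i) * r (clampVec δ p) * v i ^ 2 by ring]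
    refine mul_le_mul_of_nonneg_right (((le_abs_self _).trans ?_).trans hεδ) (sq_nonneg _)
    rw [abs_mul]
    calc _ ≤ K * (2 * B * δ) := mul_le_mul (hK δ _ hδ) (h.abs_comp_le hB hr hδ hR p)
          (abs_nonneg _) hK0
      _ = _ := by ring
  have h2 : v i * (smoothClamp δ (p i) * fderiv ℝ (fun p => r (clampVec δ p)) p v) ≤
      |v i| * (|p i| * (B * K * ‖v‖)) := by
    refine (le_abs_self _).trans ?_
    rw [abs_mul, abs_mul]
    have := abs_smoothClamp_le_abs δ (p i)
    have := h.abs_fderiv_comp_le hB hK hδ hR p v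
    gcongr
  have h3 : |v i| * (|p i| * (B * K * ‖v‖)) ≤
      ε * v i ^ 2 + (B * K) ^ 2 / (4 * ε) * (p i ^ 2 * ‖v‖ ^ 2) := by
    rw [← sq_abs (v i), ← sq_abs (p i)]
    have e : ε * |v i| ^ 2 + (B * K) ^ 2 / (4 * ε) * (|p i| ^ 2 * ‖v‖ ^ 2) -
        |v i| * (|p i| * (B * K * ‖v‖)) =
        (2 * ε * |v i| - B * K * (|p i| * ‖v‖)) ^ 2 / (4 * ε) := by
      field_simp
      ring
    have : 0 ≤ (2 * ε * |v i| - B * K * (|p i| * ‖v‖)) ^ 2 / (4 * ε) := by positivity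
    linarith
  have h4 : (B * K) ^ 2 / (4 * ε) * (p i ^ 2 * ‖v‖ ^ 2) ≤
      (B * K) ^ 2 / (4 * ε) * (p i ^ 2 * ∑ j, v j ^ 2) := by
    have := norm_sq_le_sum_sq v
    gcongr
  linarith

/-- Global modification of a vector field near a line of equilibria with eigenvalues close to
`-b₁`, `-b₂` (stable), `0` (along the line) and `a` (unstable). -/
def clampField (b₁ b₂ a : ℝ) (r₁ r₂ G r₃ : (Fin 4 → ℝ) → ℝ) (δ : ℝ) (p : Fin 4 → ℝ) : Fin 4 → ℝ :=
  ![-b₁ * p 0 + smoothClamp δ (p 0) * r₁ (clampVec δ p),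
    -b₂ * p 1 + smoothClamp δ (p 1) * r₂ (clampVec δ p),
    G (clampVec δ p),
    a * p 3 + smoothClamp δ (p 3) * r₃ (clampVec δ p)]

lemma clampField_properties {b₁ b₂ a b : ℝ} {r₁ r₂ G r₃ : (Fin 4 → ℝ) → ℝ} (ha : 0 ≤ a)
    (hb₁ : b ≤ b₁) (hb₂ : b ≤ b₂) (hB : 0 ≤ B)
    (h₁ : IsC2Near r₁ R B) (h₂ : IsC2Near r₂ R B) (hG : IsC2Near G R B) (h₃ : IsC2Near r₃ R B)
    (h₁0 : r₁ 0 = 0) (h₂0 : r₂ 0 = 0) (hG0 : fderiv ℝ G 0 = 0) (h₃0 : r₃ 0 = 0) (hK1 : 1 ≤ K)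
    (hK : ∀ δ s, 0 < δ → |deriv (smoothClamp δ) s| ≤ K) (hδ : 0 < δ) (hR : 2 * δ < R)
    (hε : 0 < ε) (hεδ : 4 * B * K * δ ≤ ε) (hab : a + 4 * ε < b - 2 * ε) :
    ContDiff ℝ 2 (clampField b₁ b₂ a r₁ r₂ G r₃ δ) ∧
    (∃ M, ∀ p, ‖fderiv ℝ (clampField b₁ b₂ a r₁ r₂ G r₃ δ) p‖ ≤ M) ∧
    IsDominated (clampField b₁ b₂ a r₁ r₂ G r₃ δ) {0, 1} (a + 4 * ε) (b - 2 * ε)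
      ((B * K) ^ 2 / (4 * ε)) := by
  have hBKδ : 0 ≤ B * K * δ := by positivity
  have hεδ' : 2 * B * K * δ ≤ ε := by linarith
  have hεδ'' : 2 * B * δ ≤ ε := by
    have : B * δ * 1 ≤ B * δ * K := by gcongr
    nlinarith
  set V := clampField b₁ b₂ a r₁ r₂ G r₃ δ with hV
  set N₁ := fun p : Fin 4 → ℝ => smoothClamp δ (p 0) * r₁ (clampVec δ p) with hN₁
  set N₂ := fun p : Fin 4 → ℝ => smoothClamp δ (p 1) * r₂ (clampVec δ p) with hN₂
  set N₀ := fun p : Fin 4 → ℝ => G (clampVec δ p) with hN₀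
  set N₃ := fun p : Fin 4 → ℝ => smoothClamp δ (p 3) * r₃ (clampVec δ p) with hN₃
  have c₁ : ContDiff ℝ 2 N₁ := h₁.contDiff_clamp_mul hδ hR 0
  have c₂ : ContDiff ℝ 2 N₂ := h₂.contDiff_clamp_mul hδ hR 1
  have c₀ : ContDiff ℝ 2 N₀ := hG.contDiff_comp hδ hR
  have c₃ : ContDiff ℝ 2 N₃ := h₃.contDiff_clamp_mul hδ hR 3
  have hd : ∀ p, HasFDerivAt V (ContinuousLinearMap.pi
      ![-b₁ • ContinuousLinearMap.proj 0 + fderiv ℝ N₁ p,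
        -b₂ • ContinuousLinearMap.proj 1 + fderiv ℝ N₂ p, fderiv ℝ N₀ p,
        a • ContinuousLinearMap.proj 3 + fderiv ℝ N₃ p]) p := fun p => by
    have hp : ∀ (i : Fin 4) (b : ℝ), HasFDerivAt (fun p : Fin 4 → ℝ => b * p i)
        (b • (ContinuousLinearMap.proj i : (Fin 4 → ℝ) →L[ℝ] ℝ)) p := fun i b =>
      (ContinuousLinearMap.proj i : (Fin 4 → ℝ) →L[ℝ] ℝ).hasFDerivAt.const_mul b
    refine hasFDerivAt_pi'.2 fun i => ?_
    fin_cases i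
    · exact (hp 0 (-b₁)).add (c₁.differentiable two_ne_zero p).hasFDerivAt
    · exact (hp 1 (-b₂)).add (c₂.differentiable two_ne_zero p).hasFDerivAt
    · exact (c₀.differentiable two_ne_zero p).hasFDerivAt
    · exact (hp 3 a).add (c₃.differentiable two_ne_zero p).hasFDerivAt
  have e : ∀ p v, fderiv ℝ V p v = ![-b₁ * v 0 + fderiv ℝ N₁ p v, -b₂ * v 1 + fderiv ℝ N₂ p v,
      fderiv ℝ N₀ p v, a * v 3 + fderiv ℝ N₃ p v] := fun p v => by
    rw [(hd p).fderiv]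
    ext i
    fin_cases i <;> simp
  have bd : ∀ (N : (Fin 4 → ℝ) → ℝ) (c : ℝ),
      (∀ p v, |fderiv ℝ N p v| ≤ c * ‖v‖) → c ≤ ε → ∀ p v, |fderiv ℝ N p v| ≤ ε * ‖v‖ :=
    fun N c h hc p v => (h p v).trans (by gcongr)
  have bd₁ := bd N₁ _ (h₁.abs_fderiv_clamp_mul_le hB h₁0 hK hδ hR 0) hεδ
  have bd₂ := bd N₂ _ (h₂.abs_fderiv_clamp_mul_le hB h₂0 hK hδ hR 1) hεδ
  have bd₀ := bd N₀ _ (hG.abs_fderiv_comp_le_of_fderiv_eq_zero hB hG0 hK hδ hR) hεδ'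
  have bd₃ := bd N₃ _ (h₃.abs_fderiv_clamp_mul_le hB h₃0 hK hδ hR 3) hεδ
  refine ⟨contDiff_pi.2 fun i => ?_, ⟨|b₁| + |b₂| + a + ε, fun p => ?_⟩, hab, by linarith,
    by positivity, fun p => ?_, fun p v => ?_, fun p v => ?_⟩
  · have hp : ∀ (i : Fin 4) (b : ℝ), ContDiff ℝ 2 (fun p : Fin 4 → ℝ => b * p i) := fun i b =>
      contDiff_const.mul (contDiff_apply ℝ ℝ i)
    fin_cases i
    · exact (hp 0 (-b₁)).add c₁
    · exact (hp 1 (-b₂)).add c₂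
    · exact c₀
    · exact (hp 3 a).add c₃
  · refine ContinuousLinearMap.opNorm_le_bound _ (by positivity) fun v => ?_
    have hv : ∀ (i : Fin 4) (b : ℝ), |b * v i| ≤ |b| * ‖v‖ := fun i b => by
      rw [abs_mul]
      exact mul_le_mul_of_nonneg_left (norm_le_pi_norm v i) (abs_nonneg _)
    have hn := norm_nonneg v
    have n1 := mul_nonneg (abs_nonneg b₁) hn
    have n2 := mul_nonneg (abs_nonneg b₂) hn
    have n3 := mul_nonneg ha hn
    have n4 := mul_nonneg hε.le hn
    rw [e]
    refine (pi_norm_le_iff_of_nonneg (by positivity)).2 fun i => ?_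
    fin_cases i
    · have := (abs_add_le _ _).trans (add_le_add (hv 0 (-b₁)) (bd₁ p v))
      rw [abs_neg] at this
      exact this.trans (by linarith)
    · have := (abs_add_le _ _).trans (add_le_add (hv 1 (-b₂)) (bd₂ p v))
      rw [abs_neg] at this
      exact this.trans (by linarith)
    · exact (bd₀ p v).trans (by linarith)
    · have := (abs_add_le _ _).trans (add_le_add (hv 3 a) (bd₃ p v))
      rw [abs_of_nonneg ha] at this
      exact this.trans (by linarith)
  · have i1 := h₁.mul_clamp_mul_le hB h₁0 hδ hR 0 p
    have i2 := h₂.mul_clamp_mul_le hB h₂0 hδ hR 1 p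
    rw [Finset.sum_pair zero_ne_one, Finset.sum_pair zero_ne_one]
    simp only [hV, clampField, Matrix.cons_val_zero, Matrix.cons_val_one]
    nlinarith [mul_le_mul_of_nonneg_right hεδ'' (sq_nonneg (p 0)),
      mul_le_mul_of_nonneg_right hεδ'' (sq_nonneg (p 1)),
      mul_le_mul_of_nonneg_right hb₁ (sq_nonneg (p 0)),
      mul_le_mul_of_nonneg_right hb₂ (sq_nonneg (p 1)),
      mul_nonneg hε.le (sq_nonneg (p 0)), mul_nonneg hε.le (sq_nonneg (p 1))]
  · have hv : ∀ (i : Fin 4) (x : ℝ), |x| ≤ ε * ‖v‖ → v i * x ≤ ε * ∑ i, v i ^ 2 := fun i x hx => by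
      calc v i * x ≤ |v i| * |x| := by rw [← abs_mul]; exact le_abs_self _
        _ ≤ ‖v‖ * (ε * ‖v‖) := mul_le_mul (norm_le_pi_norm v i) hx (abs_nonneg _) (norm_nonneg _)
        _ = ε * ‖v‖ ^ 2 := by ring
        _ ≤ _ := mul_le_mul_of_nonneg_left (norm_sq_le_sum_sq v) hε.le
    have j1 := hv 0 _ (bd₁ p v)
    have j2 := hv 1 _ (bd₂ p v)
    have j0 := hv 2 _ (bd₀ p v)
    have j3 := hv 3 _ (bd₃ p v)
    rw [e]
    simp only [Fin.sum_univ_four, Matrix.cons_val] at j1 j2 j0 j3 ⊢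
    have k1 : 0 ≤ (b₁ + a) * v 0 ^ 2 := mul_nonneg (by linarith) (sq_nonneg _)
    have k2 : 0 ≤ (b₂ + a) * v 1 ^ 2 := mul_nonneg (by linarith) (sq_nonneg _)
    have k3 : 0 ≤ a * v 2 ^ 2 := mul_nonneg (by linarith) (sq_nonneg _)
    linarith
  · have i1 := h₁.mul_fderiv_clamp_mul_le hB h₁0 hK hδ hR hε hεδ' 0 p v
    have i2 := h₂.mul_fderiv_clamp_mul_le hB h₂0 hK hδ hR hε hεδ' 1 p v
    rw [e, Finset.sum_pair zero_ne_one, Finset.sum_pair zero_ne_one, Finset.sum_pair zero_ne_one]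
    simp only [Matrix.cons_val_zero, Matrix.cons_val_one]
    have k1 := mul_le_mul_of_nonneg_right hb₁ (sq_nonneg (v 0))
    have k2 := mul_le_mul_of_nonneg_right hb₂ (sq_nonneg (v 1))
    linarith

lemma clampField_eventuallyEq (b₁ b₂ a : ℝ) (r₁ r₂ G r₃ : (Fin 4 → ℝ) → ℝ) (hδ : 0 < δ) :
    ∀ᶠ p in 𝓝 0, clampField b₁ b₂ a r₁ r₂ G r₃ δ p =
      ![p 0 * (-b₁ + r₁ p), p 1 * (-b₂ + r₂ p), G p, p 3 * (a + r₃ p)] := by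
  filter_upwards [clampVec_eventuallyEq hδ] with p hp
  have h : ∀ i, smoothClamp δ (p i) = p i := fun i => congr_fun hp i
  rw [clampField, hp, h, h, h]
  ext i
  fin_cases i <;> simp <;> ring

end ClampField

section Straightening

lemma ContDiffAt.eventually_isC2Near {E : Type*} [NormedAddCommGroup E] [NormedSpace ℝ E]
    {f : E → ℝ} (hf : ContDiffAt ℝ 2 f 0) :
    ∀ᶠ R in 𝓝[>] 0, ∀ᶠ B in atTop, IsC2Near f R B := by
  obtain ⟨R, hR, B, -, h⟩ := hf.exists_isC2Near
  filter_upwards [Ioo_mem_nhdsGT hR] with R' hR'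
  filter_upwards [eventually_ge_atTop B] with B' hB'
  exact h.mono hR'.2.le hB'

lemma eventually_forall_mem_ball {E : Type*} [SeminormedAddCommGroup E] {P : E → Prop}
    (h : ∀ᶠ q in 𝓝 0, P q) : ∀ᶠ R in 𝓝[>] (0 : ℝ), ∀ q ∈ ball (0 : E) R, P q := by
  obtain ⟨R, hR, hb⟩ := Metric.eventually_nhds_iff_ball.1 h
  filter_upwards [Ioo_mem_nhdsGT hR] with R' hR' q hq
  exact hb q (ball_subset_ball hR'.2.le hq)

lemma IsC2Near.contDiff_comp_smoothClamp {g : ℝ → ℝ} {R B δ : ℝ} (h : IsC2Near g R B) (hδ : 0 < δ)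
    (hR : 2 * δ < R) : ContDiff ℝ 2 fun s => g (smoothClamp δ s) :=
  contDiff_iff_contDiffAt.2 fun s => (h.contDiffAt _ (mem_ball_zero_iff.2
    ((abs_smoothClamp_le hδ s).trans_lt hR))).comp s (contDiff_smoothClamp δ 2).contDiffAt

lemma exists_abs_deriv_le_of_eqOn_const {g : ℝ → ℝ} (hg : ContDiff ℝ 2 g) {M c : ℝ}
    (hc : ∀ s, M ≤ |s| → g s = c) :
    ∃ B, ∀ s, |deriv g s| ≤ B ∧ |deriv (deriv g) s| ≤ B := by
  have hs : HasCompactSupport fun s => g s - c :=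
    HasCompactSupport.intro (isCompact_closedBall (0 : ℝ) M) fun s hs => by
      rw [mem_closedBall_zero_iff, not_le] at hs
      simp [hc s hs.le]
  have hd : deriv (fun s => g s - c) = deriv g := funext fun s => deriv_sub_const c
  have hs' : HasCompactSupport (deriv g) := hd ▸ hs.deriv
  obtain ⟨B₁, h₁⟩ := hs'.exists_bound_of_continuous (hg.continuous_deriv one_le_two)
  obtain ⟨B₂, h₂⟩ := hs'.deriv.exists_bound_of_continuous
    ((hg.deriv' (n := 1)).continuous_deriv le_rfl)
  exact ⟨max B₁ B₂, fun s => ⟨(h₁ s).trans (le_max_left _ _), (h₂ s).trans (le_max_right _ _)⟩⟩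

/-- A drift correction `Y` and rate corrections `h i` straighten a vector field with a line of
partially hyperbolic equilibria, provided the rates are, up to the coboundaries of `H i` and errors
`E i` vanishing on the unstable manifold, functions of the coordinate along the line. -/
theorem exists_straightening {b₁ b₂ a : ℝ} (ha : 0 < a) (hb₁ : a < b₁) (hb₂ : a < b₂)
    {r₁ r₂ G r₃ : (Fin 4 → ℝ) → ℝ} (h₁ : ContDiffAt ℝ 2 r₁ 0) (h₂ : ContDiffAt ℝ 2 r₂ 0)
    (hG : ContDiffAt ℝ 2 G 0) (h₃ : ContDiffAt ℝ 2 r₃ 0)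
    (h₁0 : r₁ 0 = 0) (h₂0 : r₂ 0 = 0) (hG0 : fderiv ℝ G 0 = 0) (h₃0 : r₃ 0 = 0)
    (hGs : ∀ᶠ q in 𝓝 0, q 0 = 0 → q 1 = 0 → G q = 0)
    {X : (Fin 4 → ℝ) → Fin 4 → ℝ}
    (hX : ∀ᶠ q in 𝓝 0, X q = ![q 0 * (-b₁ + r₁ q), q 1 * (-b₂ + r₂ q), G q, q 3 * (a + r₃ q)])
    {κ : Type*} [Finite κ] {rate H E : κ → (Fin 4 → ℝ) → ℝ} {Λ : κ → ℝ → ℝ}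
    (hH : ∀ i, ContDiffAt ℝ 1 (H i) 0) (hE : ∀ i, ContDiffAt ℝ 2 (E i) 0)
    (hEs : ∀ i, ∀ᶠ q in 𝓝 0, q 0 = 0 → q 1 = 0 → E i q = 0)
    (hΛ : ∀ i, ContDiffAt ℝ 2 (Λ i) 0)
    (hrel : ∀ i, ∀ᶠ q in 𝓝 0, rate i q + fderiv ℝ (H i) q (X q) = Λ i (q 2) + E i q) :
    ∃ (Y : (Fin 4 → ℝ) → ℝ) (h : κ → (Fin 4 → ℝ) → ℝ),
      ContDiffAt ℝ 1 Y 0 ∧ (∀ i, ContDiffAt ℝ 1 (h i) 0) ∧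
      (∀ q, q 0 = 0 → q 1 = 0 → Y q = q 2) ∧
      (∀ᶠ q in 𝓝 0, fderiv ℝ Y q (X q) = 0) ∧
      ∀ i, ∀ᶠ q in 𝓝 0, rate i q + fderiv ℝ (h i) q (X q) = Λ i (Y q) := by
  obtain ⟨K, hK1, hK⟩ := exists_abs_deriv_smoothClamp_le
  obtain ⟨R, hR1, hR2, hR3, hR4, hR5, hR6, hRG, hRE, hR⟩ :=
    (h₁.eventually_isC2Near.and <| h₂.eventually_isC2Near.and <| hG.eventually_isC2Near.and <|
      h₃.eventually_isC2Near.and <| (eventually_all.2 fun i => (hE i).eventually_isC2Near).and <|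
      (eventually_all.2 fun i => (hΛ i).eventually_isC2Near).and <|
      (eventually_forall_mem_ball hGs).and <|
      (eventually_all.2 fun i => eventually_forall_mem_ball (hEs i)).and <|
      eventually_mem_nhdsWithin).exists
  obtain ⟨B, c₁, c₂, cG, c₃, cE, cΛ, hB⟩ :=
    (hR1.and <| hR2.and <| hR3.and <| hR4.and <| (eventually_all.2 hR5).and <|
      (eventually_all.2 hR6).and <| eventually_ge_atTop 0).exists
  rw [mem_Ioi] at hR
  set b := min b₁ b₂
  have hab : a < b := lt_min hb₁ hb₂
  set ε := (b - a) / 12 with hε_def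
  have hε : 0 < ε := by rw [hε_def]; linarith
  obtain ⟨δ, hδ, hδR, hδε⟩ : ∃ δ > 0, 2 * δ < R ∧ 4 * B * K * δ ≤ ε := by
    refine ⟨min (R / 3) (ε / (4 * B * K + 1)), by positivity, ?_, ?_⟩
    · linarith [min_le_left (R / 3) (ε / (4 * B * K + 1))]
    · have h0 : 0 ≤ 4 * B * K := by positivity
      calc _ ≤ 4 * B * K * (ε / (4 * B * K + 1)) :=
            mul_le_mul_of_nonneg_left (min_le_right _ _) h0
        _ ≤ _ := by
            rw [mul_div_assoc', div_le_iff₀ (by linarith)]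
            nlinarith
  obtain ⟨hV, ⟨M, hM⟩, hD⟩ := clampField_properties ha.le (min_le_left b₁ b₂) (min_le_right b₁ b₂)
    hB c₁ c₂ cG c₃ h₁0 h₂0 hG0 h₃0 hK1 hK hδ hδR hε hδε (by rw [hε_def]; linarith)
  have hVX : ∀ᶠ q in 𝓝 0, X q = clampField b₁ b₂ a r₁ r₂ G r₃ δ q := by
    filter_upwards [hX, clampField_eventuallyEq b₁ b₂ a r₁ r₂ G r₃ hδ] with q hq hq'
    rw [hq, hq']
  have hV2 : ∀ q, clampField b₁ b₂ a r₁ r₂ G r₃ δ q 2 = G (clampVec δ q) := fun q => rfl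
  set V := clampField b₁ b₂ a r₁ r₂ G r₃ δ
  have hV1 : ContDiff ℝ 1 V := hV.of_le one_le_two
  obtain ⟨Φ, L, hΦ⟩ := exists_isSmoothFlow hV hM
  have tG := cG.isTame_comp (s := {0, 1}) hB (fun q hq hs => hRG q hq (hs 0 (by simp))
    (hs 1 (by simp))) hK1 hK hδ hδR
  have tE := fun i => (cE i).isTame_comp (s := {0, 1}) hB (fun q hq hs => hRE i q hq
    (hs 0 (by simp)) (hs 1 (by simp))) hK1 hK hδ hδR
  set g : (Fin 4 → ℝ) → ℝ := fun p => G (clampVec δ p)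
  set Λ' : κ → ℝ → ℝ := fun i s => Λ i (smoothClamp δ s) with hΛ'
  have cΛ' : ∀ i, ContDiff ℝ 2 (Λ' i) := fun i => (cΛ i).contDiff_comp_smoothClamp hδ hδR
  have dΛ' : ∀ i s, HasDerivAt (Λ' i) (deriv (Λ' i) s) s := fun i s =>
    ((cΛ' i).differentiable two_ne_zero s).hasDerivAt
  have tL : ∀ i, ∃ c, IsTame (fun p => deriv (Λ' i) (p 2) * g p) {0, 1} c := fun i => by
    obtain ⟨M', hM'⟩ := exists_abs_deriv_le_of_eqOn_const (cΛ' i) (M := 2 * δ) (c := Λ i 0)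
      fun s hs => by rw [hΛ']; simp only [smoothClamp_of_le_abs hδ hs]
    have hc : ContDiff ℝ 1 (deriv (Λ' i)) := (cΛ' i).deriv'
    refine ⟨_, tG.mul (M := M') (hc.comp (contDiff_apply ℝ ℝ (2 : Fin 4)))
      (fun p => (hM' _).1) fun p => ?_⟩
    have hd := HasDerivAt.comp_hasFDerivAt (f := fun p : Fin 4 → ℝ => p 2) p
      (hc.differentiable one_ne_zero (p 2)).hasDerivAt
      (ContinuousLinearMap.proj (2 : Fin 4) : (Fin 4 → ℝ) →L[ℝ] ℝ).hasFDerivAt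
    rw [hd.fderiv]
    refine ContinuousLinearMap.opNorm_le_bound _ ((abs_nonneg _).trans (hM' 0).2) fun v => ?_
    rw [smul_apply, norm_smul]
    exact mul_le_mul (hM' _).2 (norm_le_pi_norm v 2) (norm_nonneg _)
      ((abs_nonneg _).trans (hM' 0).2)
  choose c tL using tL
  set Y : (Fin 4 → ℝ) → ℝ := fun p => p 2 + flowMoment Φ 0 g p with hY
  have cY : ContDiff ℝ 1 Y :=
    (contDiff_apply ℝ ℝ (2 : Fin 4)).add (tG.contDiff_flowMoment hD hΦ 0)
  have hYs : ∀ q : Fin 4 → ℝ, q 0 = 0 → q 1 = 0 → Y q = q 2 := fun q h0 h1 => by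
    simp only [hY]
    rw [tG.flowMoment_eq_zero hD hΦ 0 (by simp [h0, h1]), add_zero]
  have hYV : ∀ q, fderiv ℝ Y q (V q) = 0 := fun q => by
    have hd := (ContinuousLinearMap.proj (2 : Fin 4) : (Fin 4 → ℝ) →L[ℝ] ℝ).hasFDerivAt.add
      ((tG.contDiff_flowMoment hD hΦ 0).differentiable one_ne_zero q).hasFDerivAt
    rw [HasFDerivAt.fderiv (f := Y) hd, add_apply,
      tG.fderiv_flowMoment_zero hV1 hD hΦ, ContinuousLinearMap.proj_apply, hV2]
    exact add_neg_cancel _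
  have hΛY : ∀ i q, Λ' i (q 2) + flowMoment Φ 0 (fun p => deriv (Λ' i) (p 2) * g p) q =
      Λ' i (Y q) := fun i q => by
    have hd := fun q => HasDerivAt.comp_hasFDerivAt (f := fun p : Fin 4 → ℝ => p 2) q (dΛ' i (q 2))
      (ContinuousLinearMap.proj (2 : Fin 4) : (Fin 4 → ℝ) →L[ℝ] ℝ).hasFDerivAt
    have l1 := (tL i).tendsto_of_fderiv_eq hD hΦ (g := fun p => Λ' i (p 2))
      (((cΛ' i).of_le one_le_two).comp (contDiff_apply ℝ ℝ (2 : Fin 4)))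
      (fun q => by
        rw [HasFDerivAt.fderiv (f := fun p : Fin 4 → ℝ => Λ' i (p 2)) (hd q)]
        rfl) q
    have l2 := tG.tendsto_of_fderiv_eq hD hΦ (g := fun p => p 2) (contDiff_apply ℝ ℝ (2 : Fin 4))
      (fun q => by
        rw [HasFDerivAt.fderiv (f := fun p : Fin 4 → ℝ => p 2)
          (ContinuousLinearMap.proj (2 : Fin 4) : (Fin 4 → ℝ) →L[ℝ] ℝ).hasFDerivAt]
        rfl) q
    exact tendsto_nhds_unique l1 (((cΛ' i).continuous.tendsto _).comp l2)
  set k : κ → (Fin 4 → ℝ) → ℝ := fun i p =>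
    flowMoment Φ 0 (fun p => E i (clampVec δ p)) p -
      flowMoment Φ 1 (fun p => deriv (Λ' i) (p 2) * g p) p with hk
  have ck : ∀ i, ContDiff ℝ 1 (k i) := fun i =>
    ((tE i).contDiff_flowMoment hD hΦ 0).sub ((tL i).contDiff_flowMoment hD hΦ 1)
  have hkV : ∀ i q, fderiv ℝ (k i) q (V q) = Λ' i (Y q) - Λ' i (q 2) - E i (clampVec δ q) :=
    fun i q => by
    have hd := (((tE i).contDiff_flowMoment hD hΦ 0).differentiable one_ne_zero q).hasFDerivAt.sub
      (((tL i).contDiff_flowMoment hD hΦ 1).differentiable one_ne_zero q).hasFDerivAt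
    rw [HasFDerivAt.fderiv (f := k i) hd, sub_apply,
      (tE i).fderiv_flowMoment_zero hV1 hD hΦ, (tL i).fderiv_flowMoment_one hV1 hD hΦ, ← hΛY]
    ring
  refine ⟨Y, fun i p => H i p + k i p, cY.contDiffAt, fun i => (hH i).add (ck i).contDiffAt, hYs,
    hVX.mono fun q hq => by rw [hq, hYV], fun i => ?_⟩
  have hclamp : ∀ᶠ s : ℝ in 𝓝 0, smoothClamp δ s = s := by
    filter_upwards [closedBall_mem_nhds (0 : ℝ) hδ] with s hs
    exact smoothClamp_of_abs_le hδ (mem_closedBall_zero_iff.1 hs)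
  have hY0 : Tendsto Y (𝓝 0) (𝓝 0) := by
    have := cY.continuous.tendsto 0
    rwa [hYs 0 rfl rfl] at this
  have h20 : Tendsto (fun p : Fin 4 → ℝ => p 2) (𝓝 0) (𝓝 0) :=
    (continuous_apply (2 : Fin 4)).tendsto 0
  filter_upwards [hrel i, hVX, ((hH i).eventually (by simp)), clampVec_eventuallyEq hδ,
    hY0.eventually hclamp, h20.eventually hclamp] with q e1 e2 e3 e4 e5 e6
  rw [fderiv_fun_add (e3.differentiableAt one_ne_zero) ((ck i).differentiable one_ne_zero q),
    add_apply, ← add_assoc, e1, e2, hkV, hΛ', e4]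
  simp only [e5, e6]
  ring

end Straightening

section KasnerChart

/-- The curvature term `(1/2)(N₁²+N₂²+N₃²) − (N₁N₂+N₁N₃+N₂N₃)` with `N₃, N₂, N₁ = q 0, q 1, q 3`. -/
def curvatureTerm (q : Fin 4 → ℝ) : ℝ :=
  (q 3 ^ 2 + q 1 ^ 2 + q 0 ^ 2) / 2 - (q 3 * q 1 + q 3 * q 0 + q 1 * q 0)

/-- The discriminant of the quadratic equation solved by `chartHeight c q`. -/
def chartDisc (c : ℝ) (q : Fin 4 → ℝ) : ℝ :=
  144 - 2 * (3 + (c + q 2) ^ 2) * (18 - curvatureTerm q)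

/-- The value of `Σ₁ + 4` on `ℬ`, as a function of `q = (N₃, N₂, η, N₁)`, where
`c + η = (Σ₃ − Σ₂) / (Σ₁ + 4)`. -/
def chartHeight (c : ℝ) (q : Fin 4 → ℝ) : ℝ :=
  (12 - √(chartDisc c q)) / (3 + (c + q 2) ^ 2)

/-- A parametrization of `ℬ` near the Kasner point with `(Σ₃ − Σ₂) / (Σ₁ + 4) = c`. -/
def kasnerChart (c : ℝ) (q : Fin 4 → ℝ) : Fin 6 → ℝ :=
  ![chartHeight c q - 4, 2 - chartHeight c q / 2 - (c + q 2) * chartHeight c q / 2,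
    2 - chartHeight c q / 2 + (c + q 2) * chartHeight c q / 2, q 3, q 1, q 0]

/-- The third component of the Wainwright–Hsu field in the chart. -/
def chartDrift (c : ℝ) (q : Fin 4 → ℝ) : ℝ :=
  ((c + q 2) * (-(q 0 - q 1) ^ 2 + q 3 * (q 0 + q 1)) - (q 0 - q 1) * (q 0 + q 1 - q 3))
    / chartHeight c q

/-- The constant terms of the growth rates of `N₃`, `N₂` and `N₁`. -/
def rateConst : Fin 3 → ℝ := ![-6, -6, 6]

/-- The coefficients of `chartHeight` in the growth rates of `N₃`, `N₂` and `N₁`. -/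
def rateSlope : Fin 3 → ℝ → ℝ := ![fun y ↦ 1 - y, fun y ↦ 1 + y, fun _ ↦ -2]

/-- The growth rates of `N₃`, `N₂` and `N₁` in the chart. -/
def chartRate (c : ℝ) (i : Fin 3) (q : Fin 4 → ℝ) : ℝ :=
  rateConst i + rateSlope i (c + q 2) * chartHeight c q - curvatureTerm q / 3

/-- The Wainwright–Hsu field in the chart. -/
def chartField (c : ℝ) (q : Fin 4 → ℝ) : Fin 4 → ℝ :=
  ![q 0 * chartRate c 0 q, q 1 * chartRate c 1 q, chartDrift c q, q 3 * chartRate c 2 q]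

lemma contDiff_curvatureTerm {n : WithTop ℕ∞} : ContDiff ℝ n curvatureTerm := by
  unfold curvatureTerm; fun_prop

lemma contDiff_chartDisc {n : WithTop ℕ∞} (c : ℝ) : ContDiff ℝ n (chartDisc c) := by
  have := contDiff_curvatureTerm (n := n)
  unfold chartDisc; fun_prop

lemma contDiffAt_chartHeight {n : WithTop ℕ∞} {c : ℝ} {q : Fin 4 → ℝ} (h : 0 < chartDisc c q) :
    ContDiffAt ℝ n (chartHeight c) q := by
  have h₁ := (contDiff_chartDisc (n := n) c).contDiffAt (x := q)
  have h₂ := h₁.sqrt h.ne'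
  have h₃ : (3 + (c + q 2) ^ 2) ≠ 0 := by positivity
  unfold chartHeight
  exact (contDiffAt_const.sub h₂).div (by fun_prop) h₃

lemma chartHeight_mul (c : ℝ) (q : Fin 4 → ℝ) :
    (3 + (c + q 2) ^ 2) * chartHeight c q - 12 = -√(chartDisc c q) := by
  have h₃ : (3 + (c + q 2) ^ 2) ≠ 0 := by positivity
  unfold chartHeight; field_simp; ring

lemma chartHeight_rel {c : ℝ} {q : Fin 4 → ℝ} (h : 0 ≤ chartDisc c q) :
    (3 + (c + q 2) ^ 2) * chartHeight c q ^ 2 / 2 - 12 * chartHeight c q + 18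
      = curvatureTerm q := by
  have h₁ := chartHeight_mul c q
  have h₂ := Real.sq_sqrt h
  have h₃ : (3 + (c + q 2) ^ 2) ≠ 0 := by positivity
  have h₄ : √(chartDisc c q) = 12 - (3 + (c + q 2) ^ 2) * chartHeight c q := by linarith
  rw [h₄] at h₂
  unfold chartDisc at h₂
  apply mul_left_cancel₀ h₃
  linear_combination h₂ / 2

lemma fderiv_chartHeight {c : ℝ} {q : Fin 4 → ℝ} (h : 0 < chartDisc c q) (v : Fin 4 → ℝ) :
    (c + q 2) * v 2 * chartHeight c q ^ 2 +
        ((3 + (c + q 2) ^ 2) * chartHeight c q - 12) * fderiv ℝ (chartHeight c) q v =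
      q 3 * v 3 + q 1 * v 1 + q 0 * v 0
        - (v 3 * q 1 + q 3 * v 1 + (v 3 * q 0 + q 3 * v 0) + (v 1 * q 0 + q 1 * v 0)) := by
  have hγ0 : q + (0 : ℝ) • v = q := by simp
  have hw : HasDerivAt (fun s : ℝ ↦ chartHeight c (q + s • v))
      (fderiv ℝ (chartHeight c) q v) 0 :=
    ((contDiffAt_chartHeight (n := 1) h).differentiableAt one_ne_zero).hasFDerivAt.hasLineDerivAt v
  have hi : ∀ i, HasDerivAt (fun s : ℝ ↦ (q + s • v) i) (v i) 0 := fun i ↦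
    (hasFDerivAt_apply (𝕜 := ℝ) i q).hasLineDerivAt v
  have hl := (((((hi 2).const_add c).pow 2).const_add 3).mul (hw.pow 2)).div_const 2
    |>.sub (hw.const_mul 12) |>.add_const 18
  have hr := (((hi 3).pow 2).add ((hi 1).pow 2) |>.add ((hi 0).pow 2)).div_const 2 |>.sub
    ((((hi 3).mul (hi 1)).add ((hi 3).mul (hi 0))).add ((hi 1).mul (hi 0)))
  have hev : ∀ᶠ s : ℝ in 𝓝 0, 0 < chartDisc c (q + s • v) := by
    have hc : ContinuousAt (fun s : ℝ ↦ chartDisc c (q + s • v)) 0 :=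
      ((contDiff_chartDisc (n := 0) c).continuous.comp (by fun_prop)).continuousAt
    exact hc.eventually_const_lt (by simpa using h)
  have := hr.unique (hl.congr_of_eventuallyEq ?_)
  · simp only [hγ0, Pi.pow_apply, Nat.cast_ofNat, pow_one, Nat.add_one_sub_one] at this
    linear_combination -this
  · filter_upwards [hev] with s hs
    have := chartHeight_rel hs.le
    simpa [curvatureTerm] using this.symm

lemma WHq_kasnerChart {c : ℝ} {q : Fin 4 → ℝ} (h : 0 ≤ chartDisc c q) :
    WHq (kasnerChart c q) = 2 + curvatureTerm q / 3 := by
  simp only [WHq, kasnerChart]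
  simp
  linear_combination chartHeight_rel h / 3

lemma kasnerChart_mem_WHB {c : ℝ} {q : Fin 4 → ℝ} (h : 0 ≤ chartDisc c q) :
    kasnerChart c q ∈ WHB := by
  have h₁ := chartHeight_rel h
  simp only [WHB, WHOmega, kasnerChart, mem_ofPred_eq]
  simp
  refine ⟨by ring, ?_⟩
  simp only [curvatureTerm] at h₁
  linear_combination -h₁

lemma fderiv_chartHeight_chartField {c : ℝ} {q : Fin 4 → ℝ} (h : 0 < chartDisc c q)
    (hw : chartHeight c q ≠ 0) :
    fderiv ℝ (chartHeight c) q (chartField c q) =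
      -(curvatureTerm q / 3) * (chartHeight c q - 4) -
        (2 * q 3 ^ 2 - q 1 ^ 2 - q 0 ^ 2 + 2 * q 1 * q 0 - q 3 * q 1 - q 3 * q 0) / 3 := by
  have h₁ := fderiv_chartHeight h (chartField c q)
  have h₂ := chartHeight_rel h.le
  have h₃ : (3 + (c + q 2) ^ 2) * chartHeight c q - 12 ≠ 0 := by
    rw [chartHeight_mul]; exact neg_ne_zero.2 (Real.sqrt_pos.2 h).ne'
  apply mul_left_cancel₀ h₃
  have h₄ : chartDrift c q * chartHeight c q =
      (c + q 2) * (-(q 0 - q 1) ^ 2 + q 3 * (q 0 + q 1)) - (q 0 - q 1) * (q 0 + q 1 - q 3) :=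
    div_mul_cancel₀ _ hw
  generalize fderiv ℝ (chartHeight c) q (chartField c q) = w' at *
  simp [chartField, chartRate, rateConst, rateSlope] at h₁
  generalize chartDrift c q = G at *
  generalize chartHeight c q = w at *
  simp only [curvatureTerm] at *
  generalize c + q 2 = y at *
  generalize q 0 = x₁ at *
  generalize q 1 = x₂ at *
  generalize q 3 = z at *
  linear_combination h₁ - y * w * h₄ + 2 / 3 * ((z ^ 2 + x₂ ^ 2 + x₁ ^ 2) / 2 - (z * x₂ + z * x₁ + x₂ * x₁)) * h₂

lemma contDiffAt_kasnerChart {n : WithTop ℕ∞} {c : ℝ} {q : Fin 4 → ℝ} (h : 0 < chartDisc c q) :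
    ContDiffAt ℝ n (kasnerChart c) q := by
  have := contDiffAt_chartHeight (n := n) h
  rw [contDiffAt_pi]
  intro i
  fin_cases i <;> simp [kasnerChart] <;> fun_prop

lemma fderiv_kasnerChart {c : ℝ} {q : Fin 4 → ℝ} (h : 0 < chartDisc c q)
    (hw : chartHeight c q ≠ 0) :
    fderiv ℝ (kasnerChart c) q (chartField c q) = WHX (kasnerChart c q) := by
  have h₁ := fderiv_chartHeight_chartField h hw
  have h₂ : chartField c q 2 = chartDrift c q := rfl
  have h₄ : chartDrift c q * chartHeight c q =
      (c + q 2) * (-(q 0 - q 1) ^ 2 + q 3 * (q 0 + q 1)) - (q 0 - q 1) * (q 0 + q 1 - q 3) :=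
    div_mul_cancel₀ _ hw
  have hd : HasFDerivAt (chartHeight c) (fderiv ℝ (chartHeight c) q) q :=
    ((contDiffAt_chartHeight (n := 1) h).differentiableAt one_ne_zero).hasFDerivAt
  have hq := WHq_kasnerChart h.le
  have hp : ∀ i, HasFDerivAt (fun q : Fin 4 → ℝ ↦ q i)
    (ContinuousLinearMap.proj (R := ℝ) (φ := fun _ : Fin 4 ↦ ℝ) i) q :=
    fun i ↦ hasFDerivAt_apply i q
  have hy := ((hp 2).const_add c).mul hd
  have hL : HasFDerivAt (kasnerChart c) (ContinuousLinearMap.pi ![fderiv ℝ (chartHeight c) q,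
      -(2⁻¹ : ℝ) • fderiv ℝ (chartHeight c) q -
        (2⁻¹ : ℝ) • ((c + q 2) • fderiv ℝ (chartHeight c) q + chartHeight c q • .proj 2),
      -(2⁻¹ : ℝ) • fderiv ℝ (chartHeight c) q +
        (2⁻¹ : ℝ) • ((c + q 2) • fderiv ℝ (chartHeight c) q + chartHeight c q • .proj 2),
      .proj 3, .proj 1, .proj 0]) q := by
    rw [hasFDerivAt_pi']
    intro i
    fin_cases i
    · exact hd.sub_const 4
    · refine (((hd.const_mul (-2⁻¹)).const_add 2).sub (hy.const_mul 2⁻¹)).congr_of_eventuallyEq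
        (.of_forall fun q ↦ ?_)
      simp [kasnerChart]; ring
    · refine (((hd.const_mul (-2⁻¹)).const_add 2).add (hy.const_mul 2⁻¹)).congr_of_eventuallyEq
        (.of_forall fun q ↦ ?_)
      simp [kasnerChart]; ring
    · exact hp 3
    · exact hp 1
    · exact hp 0
  rw [hL.fderiv]
  ext i
  fin_cases i <;> simp only [WHX, hq]
  · simp [h₁, kasnerChart]
  · simp [h₁, h₂, kasnerChart, curvatureTerm]
    linear_combination -h₄ / 2
  · simp [h₁, h₂, kasnerChart, curvatureTerm]
    linear_combination h₄ / 2
  · simp [chartField, chartRate, rateConst, rateSlope, kasnerChart]; ring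
  · simp [chartField, chartRate, rateConst, rateSlope, kasnerChart]; ring
  · simp [chartField, chartRate, rateConst, rateSlope, kasnerChart]; ring

/-- The value of `chartHeight` on the Kasner circle. -/
def kasnerHeight (y : ℝ) : ℝ := 6 / (2 + √(1 - y ^ 2))

/-- The larger root of the quadratic equation whose smaller root is `kasnerHeight y`. -/
def dualHeight (y : ℝ) : ℝ := 6 / (2 - √(1 - y ^ 2))

/-- A function whose derivative along the field is `chartHeight − kasnerHeight` on `{N₂ = N₃ = 0}`. -/
def heightLog (c : ℝ) (q : Fin 4 → ℝ) : ℝ :=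
  (Real.log (chartHeight c q) - Real.log (dualHeight (c + q 2) - chartHeight c q)) /
    (2 + √(1 - (c + q 2) ^ 2))

/-- The logarithm of the factor that straightens the growth rates on `{N₂ = N₃ = 0}`. -/
def chartLog (c : ℝ) (i : Fin 3) (q : Fin 4 → ℝ) : ℝ :=
  -Real.log (chartHeight c q) - rateSlope i (c + q 2) * heightLog c q

/-- The growth rates of `N₃`, `N₂` and `N₁` on the Kasner circle. -/
def kasnerRate (i : Fin 3) (y : ℝ) : ℝ := rateConst i + rateSlope i y * kasnerHeight y

lemma sqrt_one_sub_sq_lt_two (y : ℝ) : √(1 - y ^ 2) < 2 := by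
  rw [Real.sqrt_lt' two_pos]; nlinarith

lemma kasnerHeight_pos (y : ℝ) : 0 < kasnerHeight y := by unfold kasnerHeight; positivity

lemma kasnerHeight_lt_dualHeight {y : ℝ} (h : y ^ 2 < 1) : kasnerHeight y < dualHeight y := by
  have := sqrt_one_sub_sq_lt_two y
  have h₂ : 0 < √(1 - y ^ 2) := Real.sqrt_pos.2 (by linarith)
  unfold kasnerHeight dualHeight
  gcongr
  linarith

lemma curvatureTerm_zero : curvatureTerm 0 = 0 := by simp [curvatureTerm]

lemma chartDisc_zero (c : ℝ) : chartDisc c 0 = 6 ^ 2 * (1 - c ^ 2) := by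
  simp [chartDisc, curvatureTerm_zero]; ring

lemma chartHeight_eq_kasnerHeight {c : ℝ} {q : Fin 4 → ℝ} (h : (c + q 2) ^ 2 < 1)
    (hq : curvatureTerm q = 0) : chartHeight c q = kasnerHeight (c + q 2) := by
  have h₁ : chartDisc c q = 6 ^ 2 * (1 - (c + q 2) ^ 2) := by simp [chartDisc, hq]; ring
  have h₂ := Real.sq_sqrt (show 0 ≤ 1 - (c + q 2) ^ 2 by linarith)
  have h₃ : (3 + (c + q 2) ^ 2) ≠ 0 := by positivity
  have h₄ : 2 + √(1 - (c + q 2) ^ 2) ≠ 0 := by positivity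
  rw [chartHeight, kasnerHeight, h₁, Real.sqrt_mul (by positivity), Real.sqrt_sq (by norm_num),
    div_eq_div_iff h₃ h₄]
  linear_combination -6 * h₂

lemma contDiffAt_kasnerHeight {n : WithTop ℕ∞} {y : ℝ} (h : y ^ 2 < 1) :
    ContDiffAt ℝ n kasnerHeight y := by
  have h₂ : ContDiffAt ℝ n (fun y : ℝ ↦ √(1 - y ^ 2)) y :=
    ContDiffAt.sqrt (by fun_prop) (by linarith)
  exact contDiffAt_const.div (contDiffAt_const.add h₂) (by positivity)

lemma contDiff_rateSlope {n : WithTop ℕ∞} (i : Fin 3) : ContDiff ℝ n (rateSlope i) := by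
  fin_cases i
  · exact contDiff_const.sub contDiff_id
  · exact contDiff_const.add contDiff_id
  · exact contDiff_const

lemma contDiffAt_kasnerRate {n : WithTop ℕ∞} {y : ℝ} (h : y ^ 2 < 1) (i : Fin 3) :
    ContDiffAt ℝ n (kasnerRate i) y :=
  contDiffAt_const.add ((contDiff_rateSlope i).contDiffAt.mul (contDiffAt_kasnerHeight h))

/-- The points at which `chartLog` is smooth. -/
structure IsRegularAt (c : ℝ) (q : Fin 4 → ℝ) : Prop where
  sq_lt : (c + q 2) ^ 2 < 1
  disc_pos : 0 < chartDisc c q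
  height_pos : 0 < chartHeight c q
  height_lt : chartHeight c q < dualHeight (c + q 2)

lemma contDiffAt_dualHeight {n : WithTop ℕ∞} {y : ℝ} (h : y ^ 2 < 1) :
    ContDiffAt ℝ n dualHeight y := by
  have h₂ : ContDiffAt ℝ n (fun y : ℝ ↦ √(1 - y ^ 2)) y :=
    ContDiffAt.sqrt (by fun_prop) (by linarith)
  exact contDiffAt_const.div (contDiffAt_const.sub h₂)
    (sub_pos.2 (sqrt_one_sub_sq_lt_two y)).ne'

lemma IsRegularAt.contDiffAt_heightLog {n : WithTop ℕ∞} {c : ℝ} {q : Fin 4 → ℝ}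
    (h : IsRegularAt c q) : ContDiffAt ℝ n (heightLog c) q := by
  have hy : ContDiffAt ℝ n (fun q : Fin 4 → ℝ ↦ c + q 2) q := by fun_prop
  have hw := contDiffAt_chartHeight (n := n) h.disc_pos
  have hs : ContDiffAt ℝ n (fun q : Fin 4 → ℝ ↦ √(1 - (c + q 2) ^ 2)) q :=
    ContDiffAt.sqrt (by fun_prop) (by linarith [h.sq_lt])
  have hd : ContDiffAt ℝ n (fun q : Fin 4 → ℝ ↦ dualHeight (c + q 2)) q :=
    ContDiffAt.comp (g := dualHeight) q (contDiffAt_dualHeight h.sq_lt) hy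
  exact ((hw.log h.height_pos.ne').sub ((hd.sub hw).log (sub_pos.2 h.height_lt).ne')).div
    (contDiffAt_const.add hs) (by positivity)

lemma IsRegularAt.contDiffAt_chartLog {n : WithTop ℕ∞} {c : ℝ} {q : Fin 4 → ℝ}
    (h : IsRegularAt c q) (i : Fin 3) : ContDiffAt ℝ n (chartLog c i) q := by
  have hy : ContDiffAt ℝ n (fun q : Fin 4 → ℝ ↦ c + q 2) q := by fun_prop
  exact ((contDiffAt_chartHeight h.disc_pos).log h.height_pos.ne').neg.sub
    (((contDiff_rateSlope i).contDiffAt.comp q hy).mul h.contDiffAt_heightLog)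

lemma contDiffAt_chartRate {n : WithTop ℕ∞} {c : ℝ} {q : Fin 4 → ℝ} (h : 0 < chartDisc c q)
    (i : Fin 3) : ContDiffAt ℝ n (chartRate c i) q := by
  have hy : ContDiffAt ℝ n (fun q : Fin 4 → ℝ ↦ c + q 2) q := by fun_prop
  exact (contDiffAt_const.add (((contDiff_rateSlope i).contDiffAt.comp q hy).mul
    (contDiffAt_chartHeight h))).sub (contDiff_curvatureTerm.contDiffAt.div_const _)

lemma contDiffAt_chartDrift {n : WithTop ℕ∞} {c : ℝ} {q : Fin 4 → ℝ} (h : 0 < chartDisc c q)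
    (hw : chartHeight c q ≠ 0) : ContDiffAt ℝ n (chartDrift c) q :=
  ContDiffAt.div (by fun_prop) (contDiffAt_chartHeight h) hw

lemma contDiffAt_chartField {n : WithTop ℕ∞} {c : ℝ} {q : Fin 4 → ℝ} (h : 0 < chartDisc c q)
    (hw : chartHeight c q ≠ 0) : ContDiffAt ℝ n (chartField c) q := by
  have h₁ := contDiffAt_chartRate (n := n) h
  have hi : ∀ i : Fin 4, ContDiffAt ℝ n (fun q : Fin 4 → ℝ ↦ q i) q := fun i ↦ by fun_prop
  rw [contDiffAt_pi]
  intro i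
  fin_cases i
  · exact (hi 0).mul (h₁ 0)
  · exact (hi 1).mul (h₁ 1)
  · exact contDiffAt_chartDrift h hw
  · exact (hi 3).mul (h₁ 2)

lemma IsRegularAt.rate_add_fderiv_chartLog {c : ℝ} {q : Fin 4 → ℝ} (h : IsRegularAt c q)
    (h₀ : q 0 = 0) (h₁ : q 1 = 0) (i : Fin 3) :
    chartRate c i q + fderiv ℝ (chartLog c i) q (chartField c q) = kasnerRate i (c + q 2) := by
  set v := chartField c q with hv
  have hv2 : v 2 = 0 := by simp [hv, chartField, chartDrift, h₀, h₁]
  have hv0 : v 0 = 0 := by simp [hv, chartField, h₀]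
  have hv1 : v 1 = 0 := by simp [hv, chartField, h₁]
  have hv3 : v 3 = q 3 * chartRate c 2 q := rfl
  have hw : HasDerivAt (fun s : ℝ ↦ chartHeight c (q + s • v))
      (fderiv ℝ (chartHeight c) q v) 0 :=
    ((contDiffAt_chartHeight (n := 1) h.disc_pos).differentiableAt
      one_ne_zero).hasFDerivAt.hasLineDerivAt v
  have hH : HasDerivAt (fun s : ℝ ↦ chartLog c i (q + s • v))
      (fderiv ℝ (chartLog c i) q v) 0 :=
    ((h.contDiffAt_chartLog (n := 1) i).differentiableAt
      one_ne_zero).hasFDerivAt.hasLineDerivAt v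
  have hwp := h.height_pos
  have hwl := sub_pos.2 h.height_lt
  have hH' : HasDerivAt (fun s : ℝ ↦ chartLog c i (q + s • v)) _ 0 :=
    ((hw.log (by simpa using hwp.ne')).neg.sub
      ((((hw.log (by simpa using hwp.ne')).sub
        ((hw.const_sub (dualHeight (c + q 2))).log (by simpa using hwl.ne'))).div_const
          (2 + √(1 - (c + q 2) ^ 2))).const_mul (rateSlope i (c + q 2)))).congr_of_eventuallyEq
      (.of_forall fun s ↦ by simp [chartLog, heightLog, hv2])
  rw [hH.unique hH']
  have hw' : fderiv ℝ (chartHeight c) q v = -(q 3 ^ 2 / 6) * chartHeight c q := by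
    have e₁ := fderiv_chartHeight h.disc_pos v
    have e₂ := chartHeight_rel h.disc_pos.le
    have e₃ : (3 + (c + q 2) ^ 2) * chartHeight c q - 12 ≠ 0 := by
      rw [chartHeight_mul]; exact neg_ne_zero.2 (Real.sqrt_pos.2 h.disc_pos).ne'
    apply mul_left_cancel₀ e₃
    simp only [hv0, hv1, hv2, hv3, chartRate, rateConst, rateSlope, curvatureTerm, h₀, h₁] at e₁ e₂
    simp at e₁ e₂
    linear_combination e₁ + q 3 ^ 2 / 3 * e₂
  have hrel := chartHeight_rel h.disc_pos.le
  have ht := Real.sq_sqrt (show 0 ≤ 1 - (c + q 2) ^ 2 by linarith [h.sq_lt])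
  have ht2 := sub_pos.2 (sqrt_one_sub_sq_lt_two (c + q 2))
  have ht0 := Real.sqrt_nonneg (1 - (c + q 2) ^ 2)
  have hd : dualHeight (c + q 2) * (2 - √(1 - (c + q 2) ^ 2)) = 6 := div_mul_cancel₀ _ ht2.ne'
  have hk : kasnerHeight (c + q 2) * (2 + √(1 - (c + q 2) ^ 2)) = 6 :=
    div_mul_cancel₀ _ (by positivity)
  rw [hw', zero_smul, add_zero, chartRate, kasnerRate]
  simp only [curvatureTerm, h₀, h₁] at hrel ⊢
  generalize √(1 - (c + q 2) ^ 2) = t at *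
  generalize dualHeight (c + q 2) = d at *
  generalize kasnerHeight (c + q 2) = k at *
  generalize chartHeight c q = w at *
  have hz : q 3 ^ 2 = (2 + t) * (2 - t) * (w - k) * (w - d) := by
    linear_combination -2 * hrel + w ^ 2 * ht + w * (2 - t) * hk + w * (2 + t) * hd
      - k * (2 + t) * hd - 6 * hk
  have h2t : 2 + t ≠ 0 := by positivity
  have hdw := hwl.ne'
  have hkw : q 3 ^ 2 * d / (6 * (d - w) * (2 + t)) = k - w := by
    rw [hz, div_eq_iff (by positivity)]
    linear_combination (2 + t) * (w - k) * (w - d) * hd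
  rw [eq_sub_iff_add_eq] at hkw
  rw [← hkw]
  have := hwp.ne'
  field_simp
  ring

lemma isRegularAt_zero {c : ℝ} (hc : c ^ 2 < 1) : IsRegularAt c 0 := by
  have h : chartHeight c 0 = kasnerHeight c := by
    simpa using chartHeight_eq_kasnerHeight (q := 0) (by simpa using hc) curvatureTerm_zero
  refine ⟨by simpa using hc, ?_, ?_, ?_⟩
  · rw [chartDisc_zero]; linarith
  · rw [h]; exact kasnerHeight_pos c
  · simpa [h] using kasnerHeight_lt_dualHeight hc

lemma IsRegularAt.eventually {c : ℝ} {q : Fin 4 → ℝ} (h : IsRegularAt c q) :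
    ∀ᶠ q in 𝓝 q, IsRegularAt c q := by
  have hy : ContinuousAt (fun q : Fin 4 → ℝ ↦ c + q 2) q := Continuous.continuousAt (by fun_prop)
  have hw := (contDiffAt_chartHeight (n := 0) h.disc_pos).continuousAt
  have hd : ContinuousAt (fun q : Fin 4 → ℝ ↦ dualHeight (c + q 2)) q :=
    ContinuousAt.comp (g := dualHeight) (contDiffAt_dualHeight (n := 0) h.sq_lt).continuousAt hy
  filter_upwards [(hy.pow 2).eventually_lt_const h.sq_lt,
    ((contDiff_chartDisc (n := 0) c).continuous.continuousAt).eventually_const_lt h.disc_pos,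
    hw.eventually_const_lt h.height_pos, hw.eventually_lt hd h.height_lt] with q h₁ h₂ h₃ h₄
  exact ⟨h₁, h₂, h₃, h₄⟩

lemma kasnerRate_order {y : ℝ} (h₀ : 0 < y) (h₁ : y < 1) :
    kasnerRate 0 y < kasnerRate 1 y ∧ kasnerRate 1 y < 0 ∧ 0 < kasnerRate 2 y ∧
      kasnerRate 2 y < -kasnerRate 1 y := by
  have ht : 0 < √(1 - y ^ 2) := Real.sqrt_pos.2 (by nlinarith)
  have hk := kasnerHeight_pos y
  have hk' : kasnerHeight y * (2 + √(1 - y ^ 2)) = 6 := div_mul_cancel₀ _ (by positivity)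
  simp only [kasnerRate, rateConst, rateSlope]
  simp
  refine ⟨by nlinarith, by nlinarith, by nlinarith, by nlinarith⟩

lemma fderiv_chartDrift_zero {c : ℝ} (hc : c ^ 2 < 1) : fderiv ℝ (chartDrift c) 0 = 0 := by
  have h := isRegularAt_zero hc
  have hw : DifferentiableAt ℝ (chartHeight c) 0 :=
    (contDiffAt_chartHeight (n := 1) h.disc_pos).differentiableAt one_ne_zero
  have hw0 := h.height_pos.ne'
  have hA : DifferentiableAt ℝ (fun q : Fin 4 → ℝ ↦
      ((c + q 2) * (-(q 0 - q 1) + q 3) - (q 0 + q 1 - q 3)) / chartHeight c q) 0 := by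
    fun_prop (disch := assumption)
  have hB : DifferentiableAt ℝ (fun q : Fin 4 → ℝ ↦
      ((c + q 2) * ((q 0 - q 1) + q 3) + (q 0 + q 1 - q 3)) / chartHeight c q) 0 := by
    fun_prop (disch := assumption)
  have hp : ∀ i, HasFDerivAt (fun q : Fin 4 → ℝ ↦ q i)
    (ContinuousLinearMap.proj (R := ℝ) (φ := fun _ : Fin 4 ↦ ℝ) i) 0 :=
    fun i ↦ hasFDerivAt_apply i 0
  have := (((hp 0).mul hA.hasFDerivAt).add ((hp 1).mul hB.hasFDerivAt)).congr_of_eventuallyEq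
    (f₁ := chartDrift c) (.of_forall fun q ↦ by simp [chartDrift]; ring)
  rw [this.fderiv]
  simp

theorem exists_chart_straightening {c : ℝ} (h₀ : 0 < c) (h₁ : c < 1) :
    ∃ (Y : (Fin 4 → ℝ) → ℝ) (h : Fin 3 → (Fin 4 → ℝ) → ℝ),
      ContDiffAt ℝ 1 Y 0 ∧ (∀ i, ContDiffAt ℝ 1 (h i) 0) ∧ (∀ q, q 0 = 0 → q 1 = 0 → Y q = q 2) ∧
      (∀ᶠ q in 𝓝 0, fderiv ℝ Y q (chartField c q) = 0) ∧
      ∀ i, ∀ᶠ q in 𝓝 0,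
        chartRate c i q + fderiv ℝ (h i) q (chartField c q) = kasnerRate i (c + Y q) := by
  have hc : c ^ 2 < 1 := by nlinarith
  have hreg := isRegularAt_zero hc
  have hd := hreg.disc_pos
  have hr : ∀ i, ContDiffAt ℝ 2 (fun q ↦ chartRate c i q - kasnerRate i c) 0 := fun i ↦
    (contDiffAt_chartRate hd i).sub contDiffAt_const
  have hr0 : ∀ i, (fun q ↦ chartRate c i q - kasnerRate i c) 0 = 0 := fun i ↦ by
    have := chartHeight_eq_kasnerHeight (q := 0) (c := c) (by simpa using hc) curvatureTerm_zero
    simp only [chartRate, kasnerRate, this, curvatureTerm_zero]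
    simp
  have hΛ : ∀ i, ContDiffAt ℝ 2 (fun s ↦ kasnerRate i (c + s)) 0 := fun i ↦
    ContDiffAt.comp (g := kasnerRate i) _ (contDiffAt_kasnerRate (by simpa using hc) i)
      (by fun_prop)
  obtain ⟨h01, h1, h2, h21⟩ := kasnerRate_order h₀ h₁
  refine exists_straightening (b₁ := -kasnerRate 0 c) (b₂ := -kasnerRate 1 c)
    (a := kasnerRate 2 c) h2 (by linarith) h21 (hr 0) (hr 1)
    (contDiffAt_chartDrift hd hreg.height_pos.ne') (hr 2) (hr0 0) (hr0 1)
    (fderiv_chartDrift_zero hc) (hr0 2) (.of_forall fun q e₀ e₁ ↦ by simp [chartDrift, e₀, e₁])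
    (.of_forall fun q ↦ ?_) (H := chartLog c)
    (E := fun i q ↦ chartRate c i q + fderiv ℝ (chartLog c i) q (chartField c q)
      - kasnerRate i (c + q 2))
    (Λ := fun i s ↦ kasnerRate i (c + s))
    (fun i ↦ hreg.contDiffAt_chartLog i) (fun i ↦ ?_) (fun i ↦ ?_) hΛ
    (fun i ↦ .of_forall fun q ↦ by ring)
  · simp [chartField]
  · refine ((contDiffAt_chartRate hd i).add (ContDiffAt.clm_apply
      ((hreg.contDiffAt_chartLog (n := 3) i).fderiv_right (by norm_num))
      (contDiffAt_chartField hd hreg.height_pos.ne'))).sub ?_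
    exact ContDiffAt.comp (g := fun s ↦ kasnerRate i (c + s)) (f := fun q : Fin 4 → ℝ ↦ q 2)
      0 (hΛ i) (by fun_prop)
  · filter_upwards [hreg.eventually] with q hq e₀ e₁
    rw [hq.rate_add_fderiv_chartLog e₀ e₁ i, sub_self]

end KasnerChart

section Linearization

lemma exists_openPartialHomeomorph_of_eventually {E F : Type*} [NormedAddCommGroup E]
    [NormedSpace ℝ E] [CompleteSpace E] [NormedAddCommGroup F] [NormedSpace ℝ F]
    {f : E → F} {a : E} {f' : E ≃L[ℝ] F} (hf : ContDiffAt ℝ 1 f a)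
    (hf' : HasFDerivAt f (f' : E →L[ℝ] F) a) {P : E → Prop} (hP : ∀ᶠ q in 𝓝 a, P q) :
    ∃ e : OpenPartialHomeomorph E F, ⇑e = f ∧ a ∈ e.source ∧ ∀ q ∈ e.source,
      P q ∧ ContDiffAt ℝ 1 f q ∧ ContDiffAt ℝ 1 e.symm (f q) := by
  set e := hf.toOpenPartialHomeomorph f hf' one_ne_zero with he
  have hs : ContDiffAt ℝ 1 e.symm (f a) := hf.to_localInverse hf' one_ne_zero
  have hev : ∀ᶠ q in 𝓝 a, P q ∧ ContDiffAt ℝ 1 f q ∧ ContDiffAt ℝ 1 e.symm (f q) :=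
    hP.and ((hf.eventually (by simp)).and
      (hf.continuousAt.eventually (hs.eventually (by simp))))
  obtain ⟨S, hS, hSo, haS⟩ := _root_.mem_nhds_iff.1 hev
  exact ⟨e.restrOpen S hSo, rfl, ⟨hf.mem_toOpenPartialHomeomorph_source hf' one_ne_zero, haS⟩,
    fun q hq ↦ hS hq.2⟩

theorem exists_linearizing_openPartialHomeomorph {c : ℝ} (h₀ : 0 < c) (h₁ : c < 1) :
    ∃ e : OpenPartialHomeomorph (Fin 4 → ℝ) (Fin 4 → ℝ), 0 ∈ e.source ∧ e 0 = 0 ∧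
      ∀ q ∈ e.source, ContDiffAt ℝ 1 e.symm (e q) ∧ 0 < chartDisc c q ∧ 0 < chartHeight c q ∧
        (e q 0 = 0 ↔ q 0 = 0) ∧ (e q 1 = 0 ↔ q 1 = 0) ∧ (e q 3 = 0 ↔ q 3 = 0) ∧
        fderiv ℝ e.symm (e q) ![kasnerRate 0 (c + e q 2) * e q 0, kasnerRate 1 (c + e q 2) * e q 1,
          0, kasnerRate 2 (c + e q 2) * e q 3] = chartField c q := by
  obtain ⟨Y, h, hY, hh, hYs, hdY, hdh⟩ := exists_chart_straightening h₀ h₁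
  have hc : c ^ 2 < 1 := by nlinarith
  set f : (Fin 4 → ℝ) → Fin 4 → ℝ := fun q ↦ ![q 0 * Real.exp (h 0 q), q 1 * Real.exp (h 1 q),
    Y q, q 3 * Real.exp (h 2 q)] with hf
  have hp : ∀ (i : Fin 4) q, HasFDerivAt (fun q : Fin 4 → ℝ ↦ q i)
    (ContinuousLinearMap.proj (R := ℝ) (φ := fun _ : Fin 4 ↦ ℝ) i) q :=
    fun i q ↦ hasFDerivAt_apply i q
  have hpc : ∀ i : Fin 4, ContDiffAt ℝ 1 (fun q : Fin 4 → ℝ ↦ q i) 0 := fun i ↦ by fun_prop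
  have hfc : ContDiffAt ℝ 1 f 0 := by
    rw [contDiffAt_pi]
    intro i
    fin_cases i
    · exact (hpc 0).mul (hh 0).exp
    · exact (hpc 1).mul (hh 1).exp
    · exact hY
    · exact (hpc 3).mul (hh 2).exp
  have hfd : ∀ q, DifferentiableAt ℝ Y q → (∀ i, DifferentiableAt ℝ (h i) q) →
      HasFDerivAt f (ContinuousLinearMap.pi ![
        q 0 • Real.exp (h 0 q) • fderiv ℝ (h 0) q + Real.exp (h 0 q) • .proj 0,
        q 1 • Real.exp (h 1 q) • fderiv ℝ (h 1) q + Real.exp (h 1 q) • .proj 1,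
        fderiv ℝ Y q,
        q 3 • Real.exp (h 2 q) • fderiv ℝ (h 2) q + Real.exp (h 2 q) • .proj 3]) q := by
    intro q hYq hhq
    rw [hasFDerivAt_pi']
    intro i
    fin_cases i
    · exact (hp 0 q).mul (hhq 0).hasFDerivAt.exp
    · exact (hp 1 q).mul (hhq 1).hasFDerivAt.exp
    · exact hYq.hasFDerivAt
    · exact (hp 3 q).mul (hhq 2).hasFDerivAt.exp
  have hY0 : DifferentiableAt ℝ Y 0 := hY.differentiableAt one_ne_zero
  have hY2 : fderiv ℝ Y 0 (Pi.single 2 1) = 1 := by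
    have h₁ : HasDerivAt (fun s : ℝ ↦ Y (0 + s • Pi.single 2 1)) _ 0 :=
      hY0.hasFDerivAt.hasLineDerivAt (Pi.single 2 1)
    refine h₁.unique ((hasDerivAt_id 0).congr_of_eventuallyEq (.of_forall fun s ↦ ?_))
    exact (hYs (0 + s • Pi.single 2 1) (by simp) (by simp)).trans (by simp)
  have hf0 := hfd 0 hY0 fun i ↦ (hh i).differentiableAt one_ne_zero
  set L := ContinuousLinearMap.pi ![
        (0 : Fin 4 → ℝ) 0 • Real.exp (h 0 0) • fderiv ℝ (h 0) 0 + Real.exp (h 0 0) • .proj 0,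
        (0 : Fin 4 → ℝ) 1 • Real.exp (h 1 0) • fderiv ℝ (h 1) 0 + Real.exp (h 1 0) • .proj 1,
        fderiv ℝ Y 0,
        (0 : Fin 4 → ℝ) 3 • Real.exp (h 2 0) • fderiv ℝ (h 2) 0 + Real.exp (h 2 0) • .proj 3]
    with hL
  have hinj : (L : (Fin 4 → ℝ) →ₗ[ℝ] Fin 4 → ℝ).ker = ⊥ := by
    rw [LinearMap.ker_eq_bot']
    intro v hv
    have e0 : v 0 = 0 := by simpa [hL] using congrFun hv 0
    have e1 : v 1 = 0 := by simpa [hL] using congrFun hv 1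
    have e3 : v 3 = 0 := by simpa [hL] using congrFun hv 3
    have ev : v = v 2 • Pi.single 2 1 := by
      ext i; fin_cases i <;> simp [e0, e1, e3]
    have e2 : fderiv ℝ Y 0 v = 0 := by simpa [hL] using congrFun hv 2
    rw [ev, map_smul, hY2] at e2
    rw [ev, show v 2 = 0 by simpa using e2, zero_smul]
  have hsurj : (L : (Fin 4 → ℝ) →ₗ[ℝ] Fin 4 → ℝ).range = ⊤ :=
    LinearMap.ker_eq_bot_iff_range_eq_top.1 hinj
  rw [← ContinuousLinearEquiv.coe_ofBijective L hinj hsurj] at hf0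
  obtain ⟨e, hef, h0e, he⟩ := exists_openPartialHomeomorph_of_eventually hfc hf0
    ((isRegularAt_zero hc).eventually.and (hdY.and ((eventually_all.2 hdh).and
      ((hY.eventually (by simp)).and (eventually_all.2 fun i ↦ (hh i).eventually (by simp))))))
  refine ⟨e, h0e, ?_, fun q hq ↦ ?_⟩
  · rw [hef]
    ext i
    fin_cases i <;> simp [hf, hYs]
  obtain ⟨⟨hreg, hdY, hdh, hYq, hhq⟩, hfq, hsq⟩ := he q hq
  rw [hef]
  refine ⟨hsq, hreg.disc_pos, hreg.height_pos, by simp [hf], by simp [hf], by simp [hf], ?_⟩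
  have hfq' := hfd q (hYq.differentiableAt one_ne_zero) fun i ↦
    (hhq i).differentiableAt one_ne_zero
  have hcomp : (fderiv ℝ e.symm (f q)).comp (fderiv ℝ f q) = .id ℝ _ := by
    have h₁ : HasFDerivAt (e.symm ∘ f) _ q :=
      (hsq.differentiableAt one_ne_zero).hasFDerivAt.comp q
        (hfq.differentiableAt one_ne_zero).hasFDerivAt
    refine h₁.unique ((hasFDerivAt_id q).congr_of_eventuallyEq ?_)
    filter_upwards [e.open_source.mem_nhds hq] with x hx
    simpa [hef] using e.left_inv hx
  have hfX : fderiv ℝ f q (chartField c q) =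
      ![kasnerRate 0 (c + f q 2) * f q 0, kasnerRate 1 (c + f q 2) * f q 1,
          0, kasnerRate 2 (c + f q 2) * f q 3] := by
    rw [hfq'.fderiv]
    have d0 := hdh 0
    have d1 := hdh 1
    have d2 := hdh 2
    ext i
    fin_cases i
    · simp [hf, ← d0]
      simp [chartField]; ring
    · simp [hf, ← d1]
      simp [chartField]; ring
    · simpa using hdY
    · simp [hf, ← d2]
      simp [chartField]; ring
  rw [← hfX]
  exact DFunLike.congr_fun hcomp (chartField c q)

/-- There is a `C¹` linearization of the Wainwright–Hsu field near the Kasner point `p`. -/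
def IsLinearizableAt (p : Fin 6 → ℝ) : Prop :=
  ∃ ε > (0 : ℝ), ∃ U : Set (Fin 6 → ℝ), IsOpen U ∧ p ∈ U ∧
    ∃ l1 l2 lu : ℝ → ℝ,
      ContinuousOn l1 (Set.Ioo (-ε) ε) ∧ ContinuousOn l2 (Set.Ioo (-ε) ε) ∧
      ContinuousOn lu (Set.Ioo (-ε) ε) ∧
      (∀ y ∈ Set.Ioo (-ε) ε, l1 y < l2 y ∧ l2 y < 0 ∧ 0 < lu y) ∧
      ∃ φ : (Fin 4 → ℝ) → (Fin 6 → ℝ),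
        ContDiffOn ℝ 1 φ (Cube4 ε) ∧
        φ 0 = p ∧
        Set.BijOn φ (Cube4 ε) (U ∩ WHB) ∧
        (∃ ψ : (Fin 6 → ℝ) → (Fin 4 → ℝ),
          ContinuousOn ψ (U ∩ WHB) ∧ Set.InvOn ψ φ (Cube4 ε) (U ∩ WHB)) ∧
        (∀ x ∈ Cube4 ε, ∃ L : (Fin 4 → ℝ) →L[ℝ] (Fin 6 → ℝ),
          HasFDerivAt φ L x ∧
          L ![l1 (x 2) * x 0, l2 (x 2) * x 1, 0, lu (x 2) * x 3] = WHX (φ x)) ∧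
        KasnerCircle ∩ U =
          φ '' {x ∈ Cube4 ε | x 0 = 0 ∧ x 1 = 0 ∧ x 3 = 0}

lemma Cube4_eq_ball {ε : ℝ} (hε : 0 < ε) : Cube4 ε = ball 0 ε := by
  ext x
  simp only [Cube4, mem_ball_zero_iff, pi_norm_lt_iff hε, Real.norm_eq_abs, abs_lt]
  rfl

/-- The inverse of `kasnerChart c`. -/
def chartCoord (c : ℝ) (p : Fin 6 → ℝ) : Fin 4 → ℝ :=
  ![p 5, p 4, (p 2 - p 1) / (p 0 + 4) - c, p 3]

/-- The open set on which `chartCoord` inverts `kasnerChart`. -/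
def chartDomain : Set (Fin 6 → ℝ) :=
  {p | 0 < p 0 + 4 ∧ (3 * (p 0 + 4) ^ 2 + (p 2 - p 1) ^ 2) < 12 * (p 0 + 4)}

lemma isOpen_chartDomain : IsOpen chartDomain := by
  unfold chartDomain
  exact (isOpen_lt (by fun_prop) (by fun_prop)).and (isOpen_lt (by fun_prop) (by fun_prop))

lemma continuousOn_chartCoord (c : ℝ) : ContinuousOn (chartCoord c) chartDomain := by
  rw [continuousOn_pi]
  intro i
  fin_cases i
  · exact (continuous_apply 5).continuousOn
  · exact (continuous_apply 4).continuousOn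
  · exact (ContinuousOn.div (by fun_prop) (by fun_prop) fun p hp ↦ hp.1.ne').sub
      continuousOn_const
  · exact (continuous_apply 3).continuousOn

lemma chartCoord_kasnerChart {c : ℝ} {q : Fin 4 → ℝ} (hw : 0 < chartHeight c q) :
    chartCoord c (kasnerChart c q) = q := by
  have := hw.ne'
  ext i
  fin_cases i <;> simp [chartCoord, kasnerChart]
  field_simp
  ring

lemma kasnerChart_mem_chartDomain {c : ℝ} {q : Fin 4 → ℝ} (hd : 0 < chartDisc c q)
    (hw : 0 < chartHeight c q) : kasnerChart c q ∈ chartDomain := by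
  have h := chartHeight_mul c q
  have hs := Real.sqrt_pos.2 hd
  simp only [chartDomain, kasnerChart, mem_ofPred_eq]
  simp
  refine ⟨hw, ?_⟩
  nlinarith

lemma kasnerChart_chartCoord {c : ℝ} {p : Fin 6 → ℝ} (hp : p ∈ chartDomain) (hB : p ∈ WHB) :
    kasnerChart c (chartCoord c p) = p := by
  obtain ⟨h₁, h₂⟩ := hp
  obtain ⟨h₃, h₄⟩ := hB
  have hy : (c + chartCoord c p 2) * (p 0 + 4) = p 2 - p 1 := by
    simp [chartCoord, h₁.ne']
  have hy' : 3 + (c + chartCoord c p 2) ^ 2 ≠ 0 := by positivity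
  have hD : chartDisc c (chartCoord c p) =
      (12 - (3 + (c + chartCoord c p 2) ^ 2) * (p 0 + 4)) ^ 2 := by
    have hM : curvatureTerm (chartCoord c p) =
        (p 3 ^ 2 + p 4 ^ 2 + p 5 ^ 2) / 2 - (p 3 * p 4 + p 3 * p 5 + p 4 * p 5) := rfl
    have hrel : (3 + (c + chartCoord c p 2) ^ 2) * (p 0 + 4) ^ 2 / 2 - 12 * (p 0 + 4) + 18
        = curvatureTerm (chartCoord c p) := by
      have e : p 0 = -p 1 - p 2 := by linarith
      simp only [WHOmega] at h₄
      rw [hM]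
      rw [e] at h₄ hy ⊢
      linear_combination ((c + chartCoord c p 2) * (-p 1 - p 2 + 4) + (p 2 - p 1)) / 2 * hy - h₄
    rw [chartDisc, ← hrel]
    ring
  have hw : chartHeight c (chartCoord c p) = p 0 + 4 := by
    rw [chartHeight, hD, Real.sqrt_sq, sub_sub_cancel, mul_div_cancel_left₀ _ hy']
    refine (pos_of_mul_pos_left ?_ h₁.le).le
    have : (12 - (3 + (c + chartCoord c p 2) ^ 2) * (p 0 + 4)) * (p 0 + 4) =
        12 * (p 0 + 4) - (3 * (p 0 + 4) ^ 2 + (p 2 - p 1) ^ 2) := by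
      rw [← hy]; ring
    rw [this]
    linarith
  ext i
  fin_cases i
  · simp [kasnerChart, hw]
  · simp [kasnerChart, hw, hy]; linarith
  · simp [kasnerChart, hw, hy]; linarith
  all_goals rfl

lemma KasnerCircle_subset_WHB : KasnerCircle ⊆ WHB := by
  rintro p ⟨h₁, h₂, h₃, h₄, h₅⟩
  refine ⟨h₁, ?_⟩
  simp [WHOmega, h₂, h₃, h₄, h₅]

theorem isLinearizableAt_of_sorted {p : Fin 6 → ℝ} (hp : p ∈ KasnerCircle) (h0 : p 0 < -1)
    (h1 : -1 < p 1) (h12 : p 1 < p 2) : IsLinearizableAt p := by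
  have hB := KasnerCircle_subset_WHB hp
  obtain ⟨hs, hsq, h3, h4, h5⟩ := id hp
  have h2 : p 2 < 2 := by
    have : (p 0 + 1) * (p 1 + 1) < 0 := mul_neg_of_neg_of_pos (by linarith) (by linarith)
    have e : p 0 = - p 1 - p 2 := by linarith
    rw [e] at hsq this
    nlinarith
  have hw : 0 < p 0 + 4 := by linarith
  have hdom : p ∈ chartDomain := by
    refine ⟨hw, ?_⟩
    have e : p 2 = - p 1 - p 0 := by linarith
    rw [e] at hsq ⊢
    nlinarith
  obtain ⟨c, hc⟩ : ∃ c, c = (p 2 - p 1) / (p 0 + 4) := ⟨_, rfl⟩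
  have hc0 : 0 < c := hc ▸ div_pos (by linarith) hw
  have hc1 : c < 1 := by rw [hc, div_lt_one hw]; linarith
  have hcoord : chartCoord c p = 0 := by
    ext i; fin_cases i <;> simp [chartCoord, h3, h4, h5, hc]
  obtain ⟨e, h0e, he0, he⟩ := exists_linearizing_openPartialHomeomorph hc0 hc1
  have h0t : (0 : Fin 4 → ℝ) ∈ e.target := by simpa [he0] using e.map_source h0e
  have hsymm0 : e.symm 0 = 0 := by simpa [he0] using e.left_inv h0e
  obtain ⟨r, hr, hrt⟩ := Metric.isOpen_iff.1 e.open_target 0 h0t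
  obtain ⟨ε, hε, hεr⟩ : ∃ ε > 0, ε ≤ r ∧ ε ≤ c ∧ ε ≤ 1 - c :=
    ⟨min r (min c (1 - c)), by simp [hr, hc0, hc1], by simp⟩
  obtain ⟨hεr, hεc, hεc'⟩ := hεr
  have hcube : Cube4 ε ⊆ e.target := by
    rw [Cube4_eq_ball hε]; exact (ball_subset_ball hεr).trans hrt
  have hy : ∀ y ∈ Ioo (-ε) ε, 0 < c + y ∧ c + y < 1 := fun y hy ↦
    ⟨by linarith [hy.1], by linarith [hy.2]⟩
  have hrate : ∀ i, ContinuousOn (fun y ↦ kasnerRate i (c + y)) (Ioo (-ε) ε) := by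
    intro i y hy'
    obtain ⟨hy₁, hy₂⟩ := hy y hy'
    exact (ContinuousAt.comp (g := kasnerRate i)
      (contDiffAt_kasnerRate (n := 0) (by nlinarith) i).continuousAt
      (by fun_prop)).continuousWithinAt
  set V : Set (Fin 4 → ℝ) := e.source ∩ e ⁻¹' Cube4 ε with hV
  have hVo : IsOpen V := by
    rw [hV, Cube4_eq_ball hε]; exact e.isOpen_inter_preimage isOpen_ball
  set U : Set (Fin 6 → ℝ) := chartDomain ∩ chartCoord c ⁻¹' V with hU
  have hUo : IsOpen U := (continuousOn_chartCoord c).isOpen_inter_preimage isOpen_chartDomain hVo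
  set φ : (Fin 4 → ℝ) → (Fin 6 → ℝ) := fun x ↦ kasnerChart c (e.symm x) with hφ
  set ψ : (Fin 6 → ℝ) → (Fin 4 → ℝ) := fun p ↦ e (chartCoord c p) with hψ
  have hx : ∀ x ∈ Cube4 ε, ∃ q ∈ e.source, e q = x ∧ e.symm x = q := fun x hx ↦
    ⟨e.symm x, e.map_target (hcube hx), e.right_inv (hcube hx), rfl⟩
  have hmaps : MapsTo φ (Cube4 ε) (U ∩ WHB) := by
    intro x hxc
    obtain ⟨q, hq, rfl, hqx⟩ := hx x hxc
    obtain ⟨-, hd, hw, -⟩ := he q hq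
    simp only [hφ, hqx]
    refine ⟨⟨kasnerChart_mem_chartDomain hd hw, ?_⟩, kasnerChart_mem_WHB hd.le⟩
    rw [mem_preimage, chartCoord_kasnerChart hw]
    exact ⟨hq, hxc⟩
  have hmaps' : MapsTo ψ (U ∩ WHB) (Cube4 ε) := fun p hp ↦ hp.1.2.2
  have hright : ∀ p ∈ U ∩ WHB, φ (ψ p) = p := by
    rintro p ⟨⟨hp₁, hp₂, -⟩, hp₃⟩
    simp only [hφ, hψ, e.left_inv hp₂, kasnerChart_chartCoord hp₁ hp₃]
  have hinv : InvOn ψ φ (Cube4 ε) (U ∩ WHB) := by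
    refine ⟨fun x hxc ↦ ?_, hright⟩
    obtain ⟨q, hq, rfl, hqx⟩ := hx x hxc
    obtain ⟨-, hd, hw, -⟩ := he q hq
    simp only [hφ, hψ, hqx, chartCoord_kasnerChart hw]
  have hφ0 : φ 0 = p := by
    simp only [hφ, hsymm0]
    rw [← hcoord, kasnerChart_chartCoord hdom hB]
  have h0cube : (0 : Fin 4 → ℝ) ∈ Cube4 ε := by
    rw [Cube4_eq_ball hε]; exact mem_ball_self hε
  refine ⟨ε, hε, U, hUo, ?_, fun y ↦ kasnerRate 0 (c + y), fun y ↦ kasnerRate 1 (c + y),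
    fun y ↦ kasnerRate 2 (c + y), hrate 0, hrate 1, hrate 2, fun y hy' ↦ ?_, φ, ?_, hφ0,
    hinv.bijOn hmaps hmaps', ⟨ψ, ?_, hinv⟩, ?_, ?_⟩
  · rw [← hφ0]; exact (hmaps h0cube).1
  · obtain ⟨hy₁, hy₂⟩ := hy y hy'
    obtain ⟨k₁, k₂, k₃, -⟩ := kasnerRate_order hy₁ hy₂
    exact ⟨k₁, k₂, k₃⟩
  · intro x hxc
    obtain ⟨q, hq, rfl, hqx⟩ := hx x hxc
    obtain ⟨hes, hd, -⟩ := he q hq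
    refine (ContDiffAt.comp (g := kasnerChart c) _ ?_ hes).contDiffWithinAt
    rw [hqx]
    exact contDiffAt_kasnerChart hd
  · refine e.continuousOn.comp ((continuousOn_chartCoord c).mono fun p hp ↦ hp.1.1)
      fun p hp ↦ hp.1.2.1
  · intro x hxc
    obtain ⟨q, hq, rfl, hqx⟩ := hx x hxc
    obtain ⟨hes, hd, hw, -, -, -, hX⟩ := he q hq
    refine ⟨(fderiv ℝ (kasnerChart c) q).comp (fderiv ℝ e.symm (e q)), ?_, ?_⟩
    · refine HasFDerivAt.comp (g := kasnerChart c) _ ?_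
        (hes.differentiableAt one_ne_zero).hasFDerivAt
      rw [hqx]
      exact ((contDiffAt_kasnerChart (n := 1) hd).differentiableAt one_ne_zero).hasFDerivAt
    · rw [ContinuousLinearMap.comp_apply, hX, fderiv_kasnerChart hd hw.ne']
      simp only [hφ, hqx]
  · ext p
    constructor
    · rintro ⟨hpK, hpU⟩
      have hpB := KasnerCircle_subset_WHB hpK
      obtain ⟨-, -, -, i₀, i₁, i₃, -⟩ := he _ hpU.2.1
      obtain ⟨-, -, p3, p4, p5⟩ := hpK
      exact ⟨ψ p, ⟨hmaps' ⟨hpU, hpB⟩, i₀.2 p5, i₁.2 p4, i₃.2 p3⟩, hright p ⟨hpU, hpB⟩⟩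
    · rintro ⟨x, ⟨hxc, x0, x1, x3⟩, rfl⟩
      have hxm := hmaps hxc
      refine ⟨?_, hxm.1⟩
      obtain ⟨q, hq, rfl, hqx⟩ := hx x hxc
      obtain ⟨-, -, -, i₀, i₁, i₃, -⟩ := he q hq
      have hN : φ (e q) 3 = 0 ∧ φ (e q) 4 = 0 ∧ φ (e q) 5 = 0 := by
        simp only [hφ, hqx]
        exact ⟨i₃.1 x3, i₁.1 x1, i₀.1 x0⟩
      obtain ⟨hm₁, hm₂⟩ := hxm.2
      refine ⟨hm₁, ?_, hN⟩
      simp only [WHOmega, hN] at hm₂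
      linarith

lemma IsLinearizableAt.map {p : Fin 6 → ℝ} (h : IsLinearizableAt p)
    (T : (Fin 6 → ℝ) ≃L[ℝ] (Fin 6 → ℝ)) (hB : ∀ p, T p ∈ WHB ↔ p ∈ WHB)
    (hK : ∀ p, T p ∈ KasnerCircle ↔ p ∈ KasnerCircle) (hX : ∀ p, WHX (T p) = T (WHX p)) :
    IsLinearizableAt (T p) := by
  obtain ⟨ε, hε, U, hU, hpU, l1, l2, lu, c1, c2, cu, hl, φ, hφ, hφ0, hbij, ⟨ψ, hψ, hinv⟩,
    hd, hKU⟩ := h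
  have himg : (fun p ↦ T p) '' (U ∩ WHB) = T.symm ⁻¹' U ∩ WHB := by
    ext x
    constructor
    · rintro ⟨y, ⟨h₁, h₂⟩, rfl⟩
      exact ⟨by simpa using h₁, (hB y).2 h₂⟩
    · rintro ⟨h₁, h₂⟩
      refine ⟨T.symm x, ⟨h₁, ?_⟩, by simp⟩
      rw [← hB]; simpa using h₂
  have hTs : MapsTo T.symm (T.symm ⁻¹' U ∩ WHB) (U ∩ WHB) := by
    rw [← himg]
    rintro _ ⟨x, hx, rfl⟩
    simpa using hx
  refine ⟨ε, hε, T.symm ⁻¹' U, hU.preimage T.symm.continuous, by simpa using hpU, l1, l2, lu,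
    c1, c2, cu, hl, fun x ↦ T (φ x), T.contDiff.comp_contDiffOn hφ, congrArg T hφ0, ?_,
    ⟨fun x ↦ ψ (T.symm x), hψ.comp T.symm.continuous.continuousOn hTs, ?_, ?_⟩, ?_, ?_⟩
  · rw [← himg]
    exact (T.injective.injOn.bijOn_image).comp hbij
  · intro x hx
    simpa using hinv.1 hx
  · intro x hx
    have := hinv.2 (hTs hx)
    simp only [this, ContinuousLinearEquiv.apply_symm_apply]
  · intro x hx
    obtain ⟨L, hL, hLX⟩ := hd x hx
    refine ⟨(T : (Fin 6 → ℝ) →L[ℝ] (Fin 6 → ℝ)).comp L,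
      T.toContinuousLinearMap.hasFDerivAt.comp x hL, ?_⟩
    rw [hX, ← hLX]
    rfl
  · rw [← image_image (fun p ↦ T p) φ, ← hKU]
    ext x
    constructor
    · rintro ⟨h₁, h₂⟩
      refine ⟨T.symm x, ⟨?_, h₂⟩, by simp⟩
      rw [← hK]; simpa using h₁
    · rintro ⟨y, ⟨h₁, h₂⟩, rfl⟩
      exact ⟨(hK y).2 h₁, by simpa using h₂⟩

/-- The permutation of coordinates exchanging the first two axes of the Bianchi model. -/
def swapFst (p : Fin 6 → ℝ) : Fin 6 → ℝ := ![p 1, p 0, p 2, p 4, p 3, p 5]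

/-- The permutation of coordinates exchanging the last two axes of the Bianchi model. -/
def swapSnd (p : Fin 6 → ℝ) : Fin 6 → ℝ := ![p 0, p 2, p 1, p 3, p 5, p 4]

lemma swapFst_swapFst (p : Fin 6 → ℝ) : swapFst (swapFst p) = p := by
  ext i; fin_cases i <;> rfl

lemma swapSnd_swapSnd (p : Fin 6 → ℝ) : swapSnd (swapSnd p) = p := by
  ext i; fin_cases i <;> rfl

lemma swapFst_mem_KasnerCircle (p : Fin 6 → ℝ) : swapFst p ∈ KasnerCircle ↔ p ∈ KasnerCircle := by
  simp only [KasnerCircle, swapFst, mem_ofPred_eq]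
  simp
  grind

lemma swapSnd_mem_KasnerCircle (p : Fin 6 → ℝ) : swapSnd p ∈ KasnerCircle ↔ p ∈ KasnerCircle := by
  simp only [KasnerCircle, swapSnd, mem_ofPred_eq]
  simp
  grind

lemma swapFst_mem_WHB (p : Fin 6 → ℝ) : swapFst p ∈ WHB ↔ p ∈ WHB := by
  simp only [WHB, WHOmega, swapFst, mem_ofPred_eq]
  simp
  grind

lemma swapSnd_mem_WHB (p : Fin 6 → ℝ) : swapSnd p ∈ WHB ↔ p ∈ WHB := by
  simp only [WHB, WHOmega, swapSnd, mem_ofPred_eq]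
  simp
  grind

lemma WHX_swapFst (p : Fin 6 → ℝ) : WHX (swapFst p) = swapFst (WHX p) := by
  ext i; fin_cases i <;> simp [WHX, WHq, swapFst, -mul_eq_mul_right_iff] <;> ring

lemma WHX_swapSnd (p : Fin 6 → ℝ) : WHX (swapSnd p) = swapSnd (WHX p) := by
  ext i; fin_cases i <;> simp [WHX, WHq, swapSnd, -mul_eq_mul_right_iff] <;> ring

lemma IsLinearizableAt.of_swapFst {p : Fin 6 → ℝ} (h : IsLinearizableAt (swapFst p)) :
    IsLinearizableAt p := by
  let T : (Fin 6 → ℝ) ≃L[ℝ] (Fin 6 → ℝ) := LinearEquiv.toContinuousLinearEquiv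
    { toFun := swapFst
      invFun := swapFst
      map_add' := fun x y ↦ by ext i; fin_cases i <;> rfl
      map_smul' := fun x y ↦ by ext i; fin_cases i <;> rfl
      left_inv := swapFst_swapFst
      right_inv := swapFst_swapFst }
  have := h.map T swapFst_mem_WHB swapFst_mem_KasnerCircle WHX_swapFst
  rwa [show T (swapFst p) = p from swapFst_swapFst p] at this

lemma IsLinearizableAt.of_swapSnd {p : Fin 6 → ℝ} (h : IsLinearizableAt (swapSnd p)) :
    IsLinearizableAt p := by
  let T : (Fin 6 → ℝ) ≃L[ℝ] (Fin 6 → ℝ) := LinearEquiv.toContinuousLinearEquiv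
    { toFun := swapSnd
      invFun := swapSnd
      map_add' := fun x y ↦ by ext i; fin_cases i <;> rfl
      map_smul' := fun x y ↦ by ext i; fin_cases i <;> rfl
      left_inv := swapSnd_swapSnd
      right_inv := swapSnd_swapSnd }
  have := h.map T swapSnd_mem_WHB swapSnd_mem_KasnerCircle WHX_swapSnd
  rwa [show T (swapSnd p) = p from swapSnd_swapSnd p] at this

lemma isLinearizableAt_of_lt_neg_one {p : Fin 6 → ℝ} (hp : p ∈ KasnerCircle) (h0 : p 0 < -1)
    (h : (2 + 2 * p 0) * (2 + 2 * p 1) * (2 + 2 * p 2) < 0)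
    (h' : (2 + 2 * p 0) * (2 + 2 * p 1) * (2 + 2 * p 2) ≠ -32) : IsLinearizableAt p := by
  obtain ⟨hs, hsq, -⟩ := id hp
  have hpos : 0 < (1 + p 1) * (1 + p 2) := by
    by_contra! hle
    nlinarith [mul_nonneg_of_nonpos_of_nonpos (show 1 + p 0 ≤ 0 by linarith) hle]
  have h1 : -1 < p 1 := by
    by_contra! hle
    nlinarith
  have h2 : -1 < p 2 := by
    by_contra! hle
    nlinarith
  rcases lt_trichotomy (p 1) (p 2) with hlt | heq | hgt
  · exact isLinearizableAt_of_sorted hp h0 h1 hlt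
  · refine absurd ?_ h'
    have e : p 0 = -2 * p 2 := by linarith
    have e2 : p 2 = 1 := by
      rw [heq, e] at hsq
      have : (p 2 - 1) * (p 2 + 1) = 0 := by linarith
      rcases mul_eq_zero.1 this with h | h <;> linarith
    rw [heq, e, e2]; norm_num
  · exact .of_swapSnd (isLinearizableAt_of_sorted ((swapSnd_mem_KasnerCircle p).2 hp) h0 h2 hgt)

end Linearization

end

/-- C¹ linearization of the Wainwright–Hsu vector field near a non-Taub point of the
Kasner circle whose Kasner parameter is neither rational nor a quadratic irrational:
there are `ε > 0`, an open neighborhood `U` of `p`, continuous eigenvalue functions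
`λ₁ˢ < λ₂ˢ < 0 < λᵘ` on `(−ε,ε)`, and a C¹ map `φ : (−ε,ε)⁴ → ℝ⁶` which is a
homeomorphism onto `U ∩ ℬ` with `φ(0) = p`, conjugating the "linear" vector field
`(λ₁ˢ(y)x₁, λ₂ˢ(y)x₂, 0, λᵘ(y)z)` to the Wainwright–Hsu vector field `X`; moreover
`𝒦 ∩ U` is the image under `φ` of the axis `{x₁ = x₂ = z = 0}`. -/
theorem wainwrightHsu_linearization (p : Fin 6 → ℝ) (hp : p ∈ KasnerCircle)
    (hT : ¬ IsTaub p) (u : ℝ) (hu : 1 ≤ u)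
    (hK : (2 + 2 * p 0) * (2 + 2 * p 1) * (2 + 2 * p 2) =
      -216 * u ^ 2 * (1 + u) ^ 2 / (1 + u + u ^ 2) ^ 3)
    (hirr : Irrational u) (hquad : ¬ IsQuadraticIrrational u) :
    ∃ ε > (0 : ℝ), ∃ U : Set (Fin 6 → ℝ), IsOpen U ∧ p ∈ U ∧
      ∃ l1 l2 lu : ℝ → ℝ,
        ContinuousOn l1 (Set.Ioo (-ε) ε) ∧ ContinuousOn l2 (Set.Ioo (-ε) ε) ∧
        ContinuousOn lu (Set.Ioo (-ε) ε) ∧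
        (∀ y ∈ Set.Ioo (-ε) ε, l1 y < l2 y ∧ l2 y < 0 ∧ 0 < lu y) ∧
        ∃ φ : (Fin 4 → ℝ) → (Fin 6 → ℝ),
          ContDiffOn ℝ 1 φ (Cube4 ε) ∧
          φ 0 = p ∧
          Set.BijOn φ (Cube4 ε) (U ∩ WHB) ∧
          (∃ ψ : (Fin 6 → ℝ) → (Fin 4 → ℝ),
            ContinuousOn ψ (U ∩ WHB) ∧ Set.InvOn ψ φ (Cube4 ε) (U ∩ WHB)) ∧
          (∀ x ∈ Cube4 ε, ∃ L : (Fin 4 → ℝ) →L[ℝ] (Fin 6 → ℝ),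
            HasFDerivAt φ L x ∧
            L ![l1 (x 2) * x 0, l2 (x 2) * x 1, 0, lu (x 2) * x 3] = WHX (φ x)) ∧
          KasnerCircle ∩ U =
            φ '' {x ∈ Cube4 ε | x 0 = 0 ∧ x 1 = 0 ∧ x 3 = 0} := by
  have hpos : 0 < 1 + u + u ^ 2 := by positivity
  have hneg : (2 + 2 * p 0) * (2 + 2 * p 1) * (2 + 2 * p 2) < 0 := by
    rw [hK]
    exact div_neg_of_neg_of_pos (by nlinarith [show 0 < u ^ 2 * (1 + u) ^ 2 by positivity])
      (by positivity)
  have hne : (2 + 2 * p 0) * (2 + 2 * p 1) * (2 + 2 * p 2) ≠ -32 := by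
    rw [hK, ne_eq, div_eq_iff (by positivity)]
    intro h
    have : ((u - 1) * ((2 * u + 1) * (u + 2))) ^ 2 = 0 := by linear_combination h / 8
    have h₁ : u - 1 = 0 := (mul_eq_zero.1 (pow_eq_zero_iff two_ne_zero |>.1 this)).resolve_right
      (by positivity)
    exact hirr.ne_one (by linarith)
  have key : p 0 < -1 ∨ p 1 < -1 ∨ p 2 < -1 := by
    by_contra! h
    have := mul_nonneg (mul_nonneg (show 0 ≤ 2 + 2 * p 0 by linarith [h.1])
      (show 0 ≤ 2 + 2 * p 1 by linarith [h.2.1])) (show 0 ≤ 2 + 2 * p 2 by linarith [h.2.2])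
    linarith
  change IsLinearizableAt p
  rcases key with h | h | h
  · exact isLinearizableAt_of_lt_neg_one hp h hneg hne
  · refine .of_swapFst (isLinearizableAt_of_lt_neg_one ((swapFst_mem_KasnerCircle p).2 hp) h ?_ ?_)
    · simp only [swapFst]; simp; linarith
    · simp only [swapFst]; simp; contrapose! hne; linarith
  · refine .of_swapSnd (.of_swapFst (isLinearizableAt_of_lt_neg_one ((swapFst_mem_KasnerCircle _).2
      ((swapSnd_mem_KasnerCircle p).2 hp)) h ?_ ?_))
    · simp only [swapFst, swapSnd]; simp; linarith
    · simp only [swapFst, swapSnd]; simp; contrapose! hne; linarith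
end
end

section
/- The union of all closed σ-invariant aperiodic subsets of Σ₀ is dense in Σ₀: for every a ∈ Σ₀ and every neighborhood V of a in Σ₀ there exist b ∈ V and a closed set K ⊆ Σ₀ with b ∈ K, σ(K) ⊆ K, and K containing no σ-periodic point. -/
/-- The full shift space on a three-letter alphabet, `Σ = {1,2,3}^ℕ`,
with the product topology. -/
abbrev ShiftSpace := ℕ → Fin 3

/-- The shift map `σ : Σ → Σ`, `(σ a)ᵢ = a_{i+1}`. -/
def shiftMap (a : ShiftSpace) : ShiftSpace := fun i => a (i + 1)

/-- The subshift `Σ₀ = {a ∈ Σ : a_{i+1} ≠ aᵢ for all i}`. -/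
def Sigma0 : Set ShiftSpace := {a | ∀ i : ℕ, a (i + 1) ≠ a i}

open Filter Topology

theorem shiftMap_iterate_apply (n : ℕ) (a : ShiftSpace) (i : ℕ) :
    shiftMap^[n] a i = a (i + n) := by
  induction n generalizing i with
  | zero => rfl
  | succ n ih =>
    rw [Function.iterate_succ_apply']
    change shiftMap^[n] a (i + 1) = _
    rw [ih]
    congr 1
    omega

theorem isClosed_setOf_apply_ne (p q : ℕ) : IsClosed {x : ShiftSpace | x p ≠ x q} :=
  (isClosed_discrete {z : Fin 3 × Fin 3 | z.1 ≠ z.2}).preimage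
    (f := fun x : ShiftSpace => (x p, x q)) ((continuous_apply p).prodMk (continuous_apply q))

theorem isClosed_Sigma0 : IsClosed Sigma0 := by
  have h : Sigma0 = ⋂ i : ℕ, {x : ShiftSpace | x (i + 1) ≠ x i} := by
    ext x; simp [Sigma0]
  rw [h]
  exact isClosed_iInter fun i => isClosed_setOf_apply_ne _ _

theorem shiftMap_mem_Sigma0 {a : ShiftSpace} (ha : a ∈ Sigma0) : shiftMap a ∈ Sigma0 :=
  fun i => ha (i + 1)

/-- The sequences which, for each `n ≥ 1`, differ from their `n`-th shift somewhere in every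
window of length `6 * n + 1`. -/
def uniformlyAperiodic : Set ShiftSpace :=
  {x | ∀ n : ℕ, 1 ≤ n → ∀ i : ℕ, ∃ j ≤ 6 * n, x (i + j) ≠ x (i + j + n)}

theorem isClosed_uniformlyAperiodic : IsClosed uniformlyAperiodic := by
  have h : uniformlyAperiodic = ⋂ (n : ℕ) (_ : 1 ≤ n) (i : ℕ),
      ⋃ j ∈ Set.Iic (6 * n), {x : ShiftSpace | x (i + j) ≠ x (i + j + n)} := by
    ext x; simp [uniformlyAperiodic]
  rw [h]
  exact isClosed_iInter fun n => isClosed_iInter fun _ => isClosed_iInter fun i =>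
    (Set.finite_Iic _).isClosed_biUnion fun j _ => isClosed_setOf_apply_ne _ _

theorem shiftMap_mem_uniformlyAperiodic {x : ShiftSpace} (hx : x ∈ uniformlyAperiodic) :
    shiftMap x ∈ uniformlyAperiodic := by
  intro n hn i
  obtain ⟨j, hj, h⟩ := hx n hn (i + 1)
  refine ⟨j, hj, ?_⟩
  have h₁ : i + 1 + j = i + j + 1 := by omega
  have h₂ : i + 1 + j + n = i + j + n + 1 := by omega
  rwa [h₂, h₁] at h

theorem iterate_shiftMap_ne_of_mem_uniformlyAperiodic {x : ShiftSpace}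
    (hx : x ∈ uniformlyAperiodic) {n : ℕ} (hn : 1 ≤ n) : shiftMap^[n] x ≠ x := by
  intro h
  obtain ⟨j, -, hj⟩ := hx n hn 0
  apply hj
  rw [← shiftMap_iterate_apply n x, h]

/-- The Toeplitz sequence recording whether the 2-adic valuation of `i + 1` is zero, odd, or
even and positive. -/
def toeplitzSeq : ShiftSpace := fun i =>
  if padicValNat 2 (i + 1) = 0 then 0 else if padicValNat 2 (i + 1) % 2 = 1 then 1 else 2

theorem padicValNat_two_pow_mul_odd (k u : ℕ) : padicValNat 2 (2 ^ k * (2 * u + 1)) = k := by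
  rw [padicValNat.mul (by positivity) (Nat.succ_ne_zero _), padicValNat.prime_pow,
    padicValNat.eq_zero_of_not_dvd (Nat.two_not_dvd_two_mul_add_one u), add_zero]

theorem toeplitzSeq_ne {p q : ℕ}
    (h : padicValNat 2 (q + 1) = padicValNat 2 (p + 1) + 1) : toeplitzSeq p ≠ toeplitzSeq q := by
  unfold toeplitzSeq
  rw [h]
  split_ifs <;> first | decide | contradiction | omega

theorem toeplitzSeq_mem_Sigma0 : toeplitzSeq ∈ Sigma0 := by
  intro i
  unfold toeplitzSeq
  have h : ∀ m : ℕ, m ≠ 0 → (padicValNat 2 m = 0 ↔ ¬ 2 ∣ m) := by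
    intro m hm
    simp [padicValNat.eq_zero_iff, hm]
  have h₁ := h (i + 1) (by omega)
  have h₂ := h (i + 1 + 1) (by omega)
  split_ifs <;> first | decide | omega

theorem toeplitzSeq_mem_uniformlyAperiodic : toeplitzSeq ∈ uniformlyAperiodic := by
  intro n hn i
  obtain ⟨k, r, hr, hkr⟩ := Nat.exists_eq_two_pow_mul_odd (n := n) (by omega)
  obtain ⟨s, rfl⟩ := hr
  set P := 2 ^ k with hP
  have hP0 : 0 < P := by positivity
  have hPn : P ≤ n := by rw [hkr]; exact Nat.le_mul_of_pos_right _ (by omega)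
  obtain ⟨t, ht₁, ht₂⟩ : ∃ t, i + 1 + n < 4 * P * t ∧ 4 * P * t ≤ i + 1 + n + 4 * P := by
    refine ⟨(i + 1 + n) / (4 * P) + 1, Nat.lt_mul_div_succ _ (by omega), ?_⟩
    rw [mul_add, mul_one]
    exact Nat.add_le_add_right (Nat.mul_div_le _ _) _
  have hst : s ≤ 2 * t := by nlinarith
  obtain ⟨u, hu⟩ := Nat.exists_eq_add_of_le hst
  have e₁ : P * (2 * u + 1) + n = 2 ^ (k + 1) * (2 * t + 1) := by
    rw [pow_succ, ← hP, hkr]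
    linear_combination 2 * P * hu.symm
  have e₂ : 2 ^ (k + 1) * (2 * t + 1) = 4 * P * t + 2 * P := by
    rw [pow_succ, ← hP]; ring
  refine ⟨P * (2 * u + 1) - (i + 1), by omega, toeplitzSeq_ne ?_⟩
  have e₃ : i + (P * (2 * u + 1) - (i + 1)) + 1 = P * (2 * u + 1) := by omega
  have e₄ : i + (P * (2 * u + 1) - (i + 1)) + n + 1 = 2 ^ (k + 1) * (2 * t + 1) := by omega
  rw [e₃, e₄, hP, padicValNat_two_pow_mul_odd, padicValNat_two_pow_mul_odd]

/-- The sequence with the first `N` letters of `a` followed by `y`. -/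
def spliceAt (N : ℕ) (a y : ShiftSpace) : ShiftSpace := fun i => if i < N then a i else y (i - N)

theorem iterate_shiftMap_spliceAt (N : ℕ) (a y : ShiftSpace) :
    shiftMap^[N] (spliceAt N a y) = y := by
  ext i
  simp [shiftMap_iterate_apply, spliceAt]

theorem spliceAt_mem_Sigma0 {N : ℕ} {a y : ShiftSpace} (ha : a ∈ Sigma0) (hy : y ∈ Sigma0)
    (h : y 0 ≠ a N) : spliceAt (N + 1) a y ∈ Sigma0 := by
  intro i
  unfold spliceAt
  rcases lt_trichotomy i N with hi | rfl | hi
  · rw [if_pos (by omega), if_pos (by omega)]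
    exact ha i
  · simpa using h
  · rw [if_neg (by omega), if_neg (by omega), Nat.sub_add_comm (by omega)]
    exact hy _

theorem tendsto_spliceAt (a : ShiftSpace) (y : ℕ → ShiftSpace) :
    Tendsto (fun N => spliceAt (N + 1) a (y N)) atTop (𝓝 a) := by
  refine tendsto_pi_nhds.2 fun i => tendsto_const_nhds.congr' ?_
  filter_upwards [eventually_ge_atTop i] with N hN
  exact (if_pos (by omega)).symm

theorem exists_uniformlyAperiodic_apply_zero_ne (c : Fin 3) :
    ∃ y ∈ Sigma0, y ∈ uniformlyAperiodic ∧ y 0 ≠ c := by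
  by_cases h : toeplitzSeq 0 = c
  · exact ⟨shiftMap toeplitzSeq, shiftMap_mem_Sigma0 toeplitzSeq_mem_Sigma0,
      shiftMap_mem_uniformlyAperiodic toeplitzSeq_mem_uniformlyAperiodic,
      h ▸ toeplitzSeq_mem_Sigma0 0⟩
  · exact ⟨_, toeplitzSeq_mem_Sigma0, toeplitzSeq_mem_uniformlyAperiodic, h⟩

/-- The union of all closed σ-invariant aperiodic subsets of `Σ₀` is dense in `Σ₀`:
every neighborhood of a point of `Σ₀` within `Σ₀` contains a point of `Σ₀` lying in some
closed σ-invariant subset of `Σ₀` containing no σ-periodic point. -/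
theorem dense_aperiodic_invariant_sets :
    ∀ a ∈ Sigma0, ∀ V ∈ nhdsWithin a Sigma0,
      ∃ b ∈ V, b ∈ Sigma0 ∧ ∃ K : Set ShiftSpace,
        IsClosed K ∧ K ⊆ Sigma0 ∧ b ∈ K ∧ shiftMap '' K ⊆ K ∧
        ∀ c ∈ K, ∀ n : ℕ, 1 ≤ n → shiftMap^[n] c ≠ c := by
  intro a ha V hV
  choose y hy₀ hy hya using fun N => exists_uniformlyAperiodic_apply_zero_ne (a N)
  have hb : ∀ N, spliceAt (N + 1) a (y N) ∈ Sigma0 :=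
    fun N => spliceAt_mem_Sigma0 ha (hy₀ N) (hya N)
  have hlim : Tendsto (fun N => spliceAt (N + 1) a (y N)) atTop (𝓝[Sigma0] a) :=
    tendsto_nhdsWithin_iff.2 ⟨tendsto_spliceAt a y, Eventually.of_forall hb⟩
  obtain ⟨N, hN⟩ := (hlim.eventually_mem hV).exists
  have hσ : Continuous shiftMap := continuous_pi fun i => continuous_apply (i + 1)
  refine ⟨_, hN, hb N, Sigma0 ∩ shiftMap^[N + 1] ⁻¹' uniformlyAperiodic,
    isClosed_Sigma0.inter (isClosed_uniformlyAperiodic.preimage (hσ.iterate _)),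
    Set.inter_subset_left, ⟨hb N, ?_⟩, ?_, ?_⟩
  · rw [Set.mem_preimage, iterate_shiftMap_spliceAt]
    exact hy N
  · rintro _ ⟨c, ⟨hc₀, hc⟩, rfl⟩
    refine ⟨shiftMap_mem_Sigma0 hc₀, ?_⟩
    rw [Set.mem_preimage, ← Function.iterate_succ_apply, Function.iterate_succ_apply']
    exact shiftMap_mem_uniformlyAperiodic hc
  · rintro c ⟨-, hc⟩ n hn h
    apply iterate_shiftMap_ne_of_mem_uniformlyAperiodic hc hn
    rw [← Function.iterate_add_apply, Nat.add_comm, Function.iterate_add_apply, h]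
end
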